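/- arXiv:1108.5437 — 2 statements merged into one kernel-verified Lean document; each statement's English description precedes it below -/
import Mathlib

section
/- Suppose the inducing scheme F = T^φ : Y → Y is excellent (hypotheses (H1) and (H2) hold), that ‖v‖_{L∞} ≤ c‖v‖ for some c > 0 and all v ∈ B(Y) (B(Y) is embedded in L∞(Y)), and that B(X) is a collection of exchangeable observables. If μ(φ > n) = O(1/(n log n)) (and φ ∈ L¹(Y,μ)), then correlations decay at a uniform rate: there exists a sequence a_n > 0 with a_n → 0 such that for every bounded v ∈ B(X) there is a constant C_v > 0 with |ρ_{v,w}(n)| ≤ C_v |w|_∞ a_n for all w ∈ L∞(X,μ_X) and all n ≥ 1. -/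
noncomputable section

open MeasureTheory Filter Set Metric
open scoped Topology ENNReal NNReal

variable {X : Type} [MeasurableSpace X]
variable {B : Type} [NormedAddCommGroup B] [NormedSpace ℂ B] [CompleteSpace B]

/-- `R(z) = ∑_{n≥1} Rₙ zⁿ` (here `R₀ = 0` is assumed throughout). -/
def Rcal (Rn : ℕ → B →L[ℂ] B) (z : ℂ) : B →L[ℂ] B :=
  ∑' n : ℕ, z ^ n • Rn n

/-- `S_q(k,a) = ∑_{j=1}^{k} (∑_{ℓ>j} ‖R_ℓ‖) j^q e^{j a}`. -/
def Sq (Rn : ℕ → B →L[ℂ] B) (q : ℝ) (k : ℕ) (a : ℝ) : ℝ :=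
  ∑ j ∈ Finset.Icc 1 k, (∑' ℓ : ℕ, ‖Rn (j + 1 + ℓ)‖) * (j : ℝ) ^ q * Real.exp ((j : ℝ) * a)

/-- The `T`-invariant measure `μ_X` on `X` induced by `μ` and `φ`:
`μ_X(A) = (1/φ̄) ∫_Y ∑_{ℓ=0}^{φ(y)-1} 1_A(T^ℓ y) dμ(y)`. -/
def muX (μ : Measure X) (φ : X → ℕ) (T : X → X) : Measure X :=
  (ENNReal.ofReal (∫ x, (φ x : ℝ) ∂μ))⁻¹ •
    Measure.sum fun ℓ : ℕ => Measure.map T^[ℓ] (μ.restrict {x | ℓ < φ x})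

/-- the correlation function `ρ_{v,w}(n)`. -/
def rho (μX : Measure X) (T : X → X) (v w : X → ℝ) (n : ℕ) : ℝ :=
  ∫ x, v x * w (T^[n] x) ∂μX - (∫ x, v x ∂μX) * ∫ x, w x ∂μX

/-- the tail `μ(φ > n)`. -/
def tail (μ : Measure X) (φ : X → ℕ) (n : ℕ) : ℝ :=
  (μ {x | n < φ x}).toReal

/-- `v̂ : Y → ℝ` is derived from `v : X → ℝ` if for every `n ≥ 1` there is
`j ∈ {0, …, n-1}` with `v̂(y) = v(T^j y)` for all `y ∈ Y` with `φ(y) = n`. -/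
def DerivedObs (Y : Set X) (T : X → X) (φ : X → ℕ) (v vhat : X → ℝ) : Prop :=
  ∀ n : ℕ, 1 ≤ n → ∃ j, j < n ∧ ∀ y ∈ Y, φ y = n → vhat y = v (T^[j] y)

/-- `v` is exchangeable with `‖v‖ ≤ M`: every observable derived from `v` lies in
`B(Y)` with norm at most `M`. -/
def ExchBound (μ : Measure X) (Y : Set X) (T : X → X) (φ : X → ℕ)
    (ι : B →L[ℂ] Lp ℂ 1 μ) (v : X → ℝ) (M : ℝ) : Prop :=
  ∀ vhat : X → ℝ, DerivedObs Y T φ v vhat →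
    ∃ b : B, ‖b‖ ≤ M ∧ ⇑(ι b) =ᵐ[μ] fun y => (vhat y : ℂ)

/-- Uniform Cesàro convergence to zero of a family of sequences. -/
def UnifCesaro {α : Type*} (f : α → ℕ → ℝ) : Prop :=
  ∀ ε > 0, ∃ L₀ : ℕ, ∀ L ≥ L₀, ∀ a, ∑ n ∈ Finset.range L, f a n ≤ ε * L

theorem integral_exp_int_mul_I (k : ℤ) :
    ∫ θ in (0 : ℝ)..2 * Real.pi, Complex.exp (k * θ * Complex.I) =
      if k = 0 then (2 * Real.pi : ℂ) else 0 := by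
  split_ifs with h
  · simp [h]
  · have hc : (k : ℂ) * Complex.I ≠ 0 := by simp [h]
    have := integral_exp_mul_complex (a := 0) (b := 2 * Real.pi) hc
    simp_rw [show ∀ θ : ℝ, (k : ℂ) * θ * Complex.I = k * Complex.I * θ from fun θ => by ring]
    rw [this]
    have h2 : (k : ℂ) * Complex.I * ((2 * Real.pi : ℝ) : ℂ) = k * (2 * Real.pi * Complex.I) := by
      push_cast; ring
    rw [h2, Complex.exp_int_mul_two_pi_mul_I]
    simp

theorem norm_exp_nat_mul_I (n : ℕ) (θ : ℝ) : ‖Complex.exp (n * θ * Complex.I)‖ = 1 := by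
  have := Complex.norm_exp_ofReal_mul_I (n * θ)
  push_cast at this
  exact this

theorem hasSum_intervalIntegral_smul {E : Type*} [NormedAddCommGroup E] [NormedSpace ℂ E]
    {c : ℕ → ℝ → ℂ} (hc : ∀ n, Continuous (c n)) (hc1 : ∀ n θ, ‖c n θ‖ ≤ 1)
    {x : ℕ → E} (hx : Summable fun n => ‖x n‖) (a b : ℝ) :
    HasSum (fun n => (∫ θ in a..b, c n θ • x n)) (∫ θ in a..b, ∑' n, c n θ • x n) := by
  have hcont : ∀ n, Continuous fun θ => c n θ • x n := fun n => (hc n).smul continuous_const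
  refine intervalIntegral.hasSum_intervalIntegral_of_summable_norm
    (f := fun n => (⟨fun θ => c n θ • x n, hcont n⟩ : C(ℝ, E))) ?_
  refine Summable.of_nonneg_of_le (fun _ => norm_nonneg _) (fun n => ?_) hx
  refine (ContinuousMap.norm_le _ (norm_nonneg _)).2 fun θ => ?_
  simpa [norm_smul] using mul_le_mul_of_nonneg_right (hc1 n θ) (norm_nonneg (x n))

/-- Extraction of a Fourier coefficient from an absolutely convergent series. -/
theorem integral_exp_smul_tsum {E : Type*} [NormedAddCommGroup E] [NormedSpace ℂ E]
    [CompleteSpace E] {x : ℕ → E} (hx : Summable fun n => ‖x n‖) (n : ℕ) :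
    ∫ θ in (0 : ℝ)..2 * Real.pi, Complex.exp (-(n * θ * Complex.I)) •
        ∑' m : ℕ, Complex.exp (m * θ * Complex.I) • x m = (2 * Real.pi : ℂ) • x n := by
  have h := hasSum_intervalIntegral_smul
    (c := fun m θ => Complex.exp (((m - n : ℤ) : ℂ) * θ * Complex.I)) (fun m => by fun_prop)
    (fun m θ => by
      have := Complex.norm_exp_ofReal_mul_I ((m - n : ℤ) * θ)
      push_cast at this ⊢
      exact this.le) hx 0 (2 * Real.pi)
  have h2 : ∀ θ : ℝ, Complex.exp (-(n * θ * Complex.I)) •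
      ∑' m : ℕ, Complex.exp (m * θ * Complex.I) • x m =
      ∑' m : ℕ, Complex.exp (((m - n : ℤ) : ℂ) * θ * Complex.I) • x m := by
    intro θ
    rw [← tsum_const_smul'']
    refine tsum_congr fun m => ?_
    rw [smul_smul, ← Complex.exp_add]
    congr 2
    push_cast
    ring
  simp_rw [h2]
  refine h.unique ?_
  simp_rw [intervalIntegral.integral_smul_const, integral_exp_int_mul_I]
  convert hasSum_single n ?_ using 1
  · simp
  · intro m hm
    simp [sub_eq_zero, hm]

/-- Parseval's identity for absolutely convergent series in a Hilbert space. -/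
theorem hasSum_sq_norm_fourier {H : Type*} [NormedAddCommGroup H] [InnerProductSpace ℂ H]
    [CompleteSpace H] {x : ℕ → H} (hx : Summable fun n => ‖x n‖) :
    HasSum (fun n => 2 * Real.pi * ‖x n‖ ^ 2)
      (∫ θ in (0 : ℝ)..2 * Real.pi, ‖∑' m : ℕ, Complex.exp (m * θ * Complex.I) • x m‖ ^ 2) := by
  set f : ℝ → H := fun θ => ∑' m : ℕ, Complex.exp (m * θ * Complex.I) • x m with hf
  have hsum : ∀ θ : ℝ, Summable fun m : ℕ => Complex.exp (m * θ * Complex.I) • x m := fun θ =>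
    Summable.of_norm (by simpa [norm_smul, norm_exp_nat_mul_I] using hx)
  have hfc : Continuous f := by
    refine continuous_tsum (u := fun n => ‖x n‖) (fun n => by fun_prop) hx fun n θ => ?_
    rw [norm_smul, norm_exp_nat_mul_I, one_mul]
  have hfb : ∀ θ, ‖f θ‖ ≤ ∑' n, ‖x n‖ := fun θ => by
    refine tsum_of_norm_bounded hx.hasSum fun n => ?_
    rw [norm_smul, norm_exp_nat_mul_I, one_mul]
  set D := ∑' n, ‖x n‖
  have hD : 0 ≤ D := tsum_nonneg fun _ => norm_nonneg _
  have key : ∀ n, ∫ θ in (0 : ℝ)..2 * Real.pi,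
      inner ℂ (x n) (Complex.exp (-(n * θ * Complex.I)) • f θ) = 2 * Real.pi * ‖x n‖ ^ 2 := by
    intro n
    have := (innerSL ℂ (x n)).intervalIntegral_comp_comm (a := 0) (b := 2 * Real.pi) (μ := volume)
      (f := fun θ : ℝ => Complex.exp (-(n * θ * Complex.I)) • f θ)
      (Continuous.intervalIntegrable (by fun_prop) _ _)
    simp only [innerSL_apply_apply] at this
    rw [this, integral_exp_smul_tsum hx, inner_smul_right, inner_self_eq_norm_sq_to_K]
    simp
  have key2 : ∀ n, ∫ θ in (0 : ℝ)..2 * Real.pi,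
      Complex.re (inner ℂ (x n) (Complex.exp (-(n * θ * Complex.I)) • f θ)) =
        2 * Real.pi * ‖x n‖ ^ 2 := by
    intro n
    have := Complex.reCLM.intervalIntegral_comp_comm (a := 0) (b := 2 * Real.pi) (μ := volume)
      (f := fun θ : ℝ => inner ℂ (x n) (Complex.exp (-(n * θ * Complex.I)) • f θ))
      (Continuous.intervalIntegrable (by fun_prop) _ _)
    simp only [Complex.reCLM_apply] at this
    rw [this, key]
    norm_cast
  have hpt : ∀ θ : ℝ, HasSum
      (fun n : ℕ => Complex.re (inner ℂ (x n) (Complex.exp (-(n * θ * Complex.I)) • f θ)))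
      (‖f θ‖ ^ 2) := by
    intro θ
    have h1 : HasSum (fun n : ℕ => inner ℂ (f θ) (Complex.exp (n * θ * Complex.I) • x n))
        (inner ℂ (f θ) (f θ)) := (innerSL ℂ (f θ)).hasSum (hsum θ).hasSum
    have h2 := Complex.hasSum_re h1
    have h3 : (inner ℂ (f θ) (f θ)).re = ‖f θ‖ ^ 2 := by
      rw [inner_self_eq_norm_sq_to_K]; norm_cast
    rw [h3] at h2
    convert h2 using 2 with n
    rw [← inner_conj_symm, Complex.conj_re, inner_smul_left, inner_smul_right,
      ← Complex.exp_conj]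
    simp
  have h := intervalIntegral.hasSum_integral_of_dominated_convergence (μ := volume)
    (a := 0) (b := 2 * Real.pi)
    (F := fun (n : ℕ) (θ : ℝ) =>
      Complex.re (inner ℂ (x n) (Complex.exp (-(n * θ * Complex.I)) • f θ)))
    (f := fun θ => ‖f θ‖ ^ 2)
    (fun n _ => ‖x n‖ * D) (fun n => (Continuous.aestronglyMeasurable (by fun_prop)))
    (fun n => Eventually.of_forall fun θ _ => ?_)
    (Eventually.of_forall fun θ _ => hx.mul_right D) (by simp)
    (Eventually.of_forall fun θ _ => hpt θ)
  · simpa only [key2] using h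
  · refine (Complex.abs_re_le_norm _).trans ((norm_inner_le_norm _ _).trans ?_)
    refine mul_le_mul_of_nonneg_left ?_ (norm_nonneg _)
    rw [norm_smul, Complex.exp_neg, norm_inv, norm_exp_nat_mul_I, inv_one, one_mul]
    exact hfb θ

theorem hasSum_sq_norm_powerSeries {H : Type*} [NormedAddCommGroup H] [InnerProductSpace ℂ H]
    [CompleteSpace H] {c : ℕ → H} {G : ℂ → H}
    (hG : ∀ z : ℂ, ‖z‖ < 1 → HasSum (fun n => z ^ n • c n) (G z))
    (hc : ∀ r : ℝ, 0 ≤ r → r < 1 → Summable fun n => r ^ n * ‖c n‖) {r : ℝ} (hr : 0 ≤ r)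
    (hr1 : r < 1) :
    HasSum (fun n => 2 * Real.pi * (r ^ n * ‖c n‖) ^ 2)
      (∫ θ in (0 : ℝ)..2 * Real.pi, ‖G (r * Complex.exp (θ * Complex.I))‖ ^ 2) := by
  have hx : Summable fun n => ‖(r : ℂ) ^ n • c n‖ := by
    simpa [norm_smul, abs_of_nonneg hr] using hc r hr hr1
  convert hasSum_sq_norm_fourier hx using 2
  · simp [norm_smul, abs_of_nonneg hr]
  · ext θ
    have hz : ‖(r : ℂ) * Complex.exp (θ * Complex.I)‖ < 1 := by
      simpa [abs_of_nonneg hr] using hr1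
    rw [← (hG _ hz).tsum_eq]
    congr 2
    refine tsum_congr fun n => ?_
    rw [smul_smul, mul_pow, ← Complex.exp_nat_mul, mul_comm, mul_assoc (n : ℂ)]

/-- Coefficients of a Hilbert space valued power series are small on average when the
singularity at `1` is weaker than a simple pole, uniformly over a family. -/
theorem unifCesaro_norm_coeff {α H : Type*} [NormedAddCommGroup H] [InnerProductSpace ℂ H]
    [CompleteSpace H] {c : α → ℕ → H} {G : α → ℂ → H}
    (hG : ∀ a, ∀ z : ℂ, ‖z‖ < 1 → HasSum (fun n => z ^ n • c a n) (G a z))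
    (hc : ∀ a, ∀ r : ℝ, 0 ≤ r → r < 1 → Summable fun n => r ^ n * ‖c a n‖)
    (hb : ∀ ε > 0, ∃ K : ℝ, ∀ a, ∀ z : ℂ, ‖z‖ < 1 → ‖G a z‖ ≤ ε / ‖1 - z‖ + K) :
    UnifCesaro fun a n => ‖c a n‖ := by
  intro δ hδ
  have he : 0 < Real.exp 1 := Real.exp_pos 1
  set e := Real.exp 1 with he_def
  obtain ⟨K, hK⟩ := hb (δ / (4 * e)) (by positivity)
  set ε := δ / (4 * e) with hε
  refine ⟨⌈4 * K ^ 2 * e ^ 2 / δ ^ 2⌉₊ + 1, fun L hL a => ?_⟩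
  have hL1 : (1 : ℝ) ≤ L := by exact_mod_cast (by omega : 1 ≤ L)
  have hLK : 4 * K ^ 2 * e ^ 2 ≤ δ ^ 2 * L := by
    have h1 : 4 * K ^ 2 * e ^ 2 / δ ^ 2 ≤ L :=
      (Nat.le_ceil _).trans (by exact_mod_cast (by omega))
    rw [div_le_iff₀ (by positivity)] at h1
    linarith
  set r : ℝ := L / (L + 1) with hr_def
  have hr0 : 0 < r := by positivity
  have hr1 : r < 1 := by rw [hr_def, div_lt_one (by positivity)]; linarith
  have h1r : 1 - r = 1 / (L + 1) := by rw [hr_def]; field_simp; ring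
  have hrL : ∀ n < L, 1 ≤ r ^ n * e := by
    intro n hn
    have h1 : r⁻¹ ≤ Real.exp (1 / L) := by
      have := Real.add_one_le_exp (1 / (L : ℝ))
      refine le_trans (le_of_eq ?_) this
      rw [hr_def]; field_simp
      ring
    have h2 : (r⁻¹) ^ n ≤ e := by
      calc (r⁻¹) ^ n ≤ (Real.exp (1 / L)) ^ n := pow_le_pow_left₀ (by positivity) h1 _
        _ = Real.exp (n * (1 / L)) := (Real.exp_nat_mul _ _).symm
        _ ≤ Real.exp 1 := by
          refine Real.exp_le_exp.2 ?_
          rw [mul_one_div, div_le_one (by linarith)]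
          exact_mod_cast hn.le
    rw [inv_pow, inv_le_comm₀ (by positivity) he] at h2
    calc (1 : ℝ) = e⁻¹ * e := by field_simp
      _ ≤ r ^ n * e := mul_le_mul_of_nonneg_right h2 he.le
  have hgeo := hasSum_sq_norm_powerSeries (H := ℂ) (c := fun _ => 1) (G := fun z => (1 - z)⁻¹)
    (fun z hz => by simpa using hasSum_geometric_of_norm_lt_one hz)
    (fun r h0 h1 => by simpa using summable_geometric_of_lt_one h0 h1) hr0.le hr1
  have hgeo2 : HasSum (fun n : ℕ => 2 * Real.pi * (r ^ n * ‖(1 : ℂ)‖) ^ 2)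
      (2 * Real.pi * (1 - r ^ 2)⁻¹) := by
    have := (hasSum_geometric_of_lt_one (sq_nonneg r)
      (by nlinarith : r ^ 2 < 1)).mul_left (2 * Real.pi)
    have hfun : (fun n : ℕ => 2 * Real.pi * (r ^ n * ‖(1 : ℂ)‖) ^ 2) =
        fun n => 2 * Real.pi * (r ^ 2) ^ n := by
      ext n
      rw [norm_one]
      ring
    rwa [hfun]
  have hint := hgeo.unique hgeo2
  have hmain := hasSum_sq_norm_powerSeries (hG a) (hc a) hr0.le hr1
  have hzr : ∀ θ : ℝ, ‖(r : ℂ) * Complex.exp (θ * Complex.I)‖ < 1 := fun θ => by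
    simpa [abs_of_nonneg hr0.le] using hr1
  have hne : ∀ θ : ℝ, 1 - (r : ℂ) * Complex.exp (θ * Complex.I) ≠ 0 := fun θ h => by
    have := hzr θ
    rw [← sub_eq_zero.1 h] at this
    simp at this
  have hcont : Continuous fun θ : ℝ =>
      2 * ε ^ 2 * ‖(1 - (r : ℂ) * Complex.exp (θ * Complex.I))⁻¹‖ ^ 2 + 2 * K ^ 2 := by
    have : Continuous fun θ : ℝ => (1 - (r : ℂ) * Complex.exp (θ * Complex.I))⁻¹ :=
      Continuous.inv₀ (by fun_prop) hne
    fun_prop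
  have hle : ∫ θ in (0 : ℝ)..2 * Real.pi, ‖G a (r * Complex.exp (θ * Complex.I))‖ ^ 2 ≤
      ∫ θ in (0 : ℝ)..2 * Real.pi,
        (2 * ε ^ 2 * ‖(1 - (r : ℂ) * Complex.exp (θ * Complex.I))⁻¹‖ ^ 2 + 2 * K ^ 2) := by
    rw [intervalIntegral.integral_of_le (by positivity),
      intervalIntegral.integral_of_le (by positivity)]
    refine integral_mono_of_nonneg (Eventually.of_forall fun _ => by positivity)
      (hcont.integrableOn_Ioc) (Eventually.of_forall fun θ => ?_)
    have h := hK a _ (hzr θ)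
    simp only [norm_inv]
    rw [div_eq_mul_inv] at h
    set A := ‖1 - (r : ℂ) * Complex.exp (θ * Complex.I)‖⁻¹
    have h0 := norm_nonneg (G a (r * Complex.exp (θ * Complex.I)))
    nlinarith [sq_nonneg (ε * A - K), pow_le_pow_left₀ h0 h 2]
  have hval : ∫ θ in (0 : ℝ)..2 * Real.pi,
        (2 * ε ^ 2 * ‖(1 - (r : ℂ) * Complex.exp (θ * Complex.I))⁻¹‖ ^ 2 + 2 * K ^ 2) =
      2 * Real.pi * (2 * ε ^ 2 * (1 - r ^ 2)⁻¹ + 2 * K ^ 2) := by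
    have hc2 : Continuous fun θ : ℝ =>
        2 * ε ^ 2 * ‖(1 - (r : ℂ) * Complex.exp (θ * Complex.I))⁻¹‖ ^ 2 := by
      have : Continuous fun θ : ℝ => (1 - (r : ℂ) * Complex.exp (θ * Complex.I))⁻¹ :=
        Continuous.inv₀ (by fun_prop) hne
      fun_prop
    rw [intervalIntegral.integral_add (hc2.intervalIntegrable _ _) (by simp),
      intervalIntegral.integral_const_mul, hint]
    simp
    ring
  rw [hval] at hle
  have hfin : ∑ n ∈ Finset.range L, 2 * Real.pi * (r ^ n * ‖c a n‖) ^ 2 ≤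
      2 * Real.pi * (2 * ε ^ 2 * (1 - r ^ 2)⁻¹ + 2 * K ^ 2) :=
    (sum_le_hasSum _ (fun _ _ => by positivity) hmain).trans hle
  rw [← Finset.mul_sum] at hfin
  have hfin2 := le_of_mul_le_mul_left hfin (by positivity)
  have hrinv : (1 - r ^ 2)⁻¹ ≤ (L : ℝ) + 1 := by
    rw [inv_le_comm₀ (by nlinarith) (by positivity)]
    have : (1 - r ^ 2) = (1 - r) * (1 + r) := by ring
    rw [this, h1r, one_div]
    nlinarith [inv_pos.2 (by positivity : (0 : ℝ) < L + 1)]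
  have hsq : ∑ n ∈ Finset.range L, ‖c a n‖ ^ 2 ≤
      e ^ 2 * ∑ n ∈ Finset.range L, (r ^ n * ‖c a n‖) ^ 2 := by
    rw [Finset.mul_sum]
    refine Finset.sum_le_sum fun n hn => ?_
    have h1 := hrL n (Finset.mem_range.1 hn)
    calc ‖c a n‖ ^ 2 = (1 * ‖c a n‖) ^ 2 := by rw [one_mul]
      _ ≤ ((r ^ n * e) * ‖c a n‖) ^ 2 := by gcongr
      _ = _ := by ring
  have hCS : (∑ n ∈ Finset.range L, ‖c a n‖) ^ 2 ≤ L * ∑ n ∈ Finset.range L, ‖c a n‖ ^ 2 := by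
    simpa using sq_sum_le_card_mul_sum_sq (s := Finset.range L) (f := fun n => ‖c a n‖)
  have hεe : 16 * (ε ^ 2 * e ^ 2) = δ ^ 2 := by rw [hε]; field_simp; ring
  refine (sq_le_sq₀ (by positivity) (by positivity)).1 ?_
  have hA : ∑ n ∈ Finset.range L, ‖c a n‖ ^ 2 ≤ e ^ 2 * (2 * ε ^ 2 * (2 * L) + 2 * K ^ 2) := by
    refine hsq.trans (mul_le_mul_of_nonneg_left (hfin2.trans ?_) (by positivity))
    have : (1 - r ^ 2)⁻¹ ≤ 2 * (L : ℝ) := by linarith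
    gcongr
  have hB : e ^ 2 * (2 * ε ^ 2 * (2 * L) + 2 * K ^ 2) ≤ δ ^ 2 * L := by nlinarith
  calc _ ≤ (L : ℝ) * ∑ n ∈ Finset.range L, ‖c a n‖ ^ 2 := hCS
    _ ≤ L * (δ ^ 2 * L) := by gcongr; exact hA.trans hB
    _ = _ := by ring

section Resolvent

variable {B : Type} [NormedAddCommGroup B] [NormedSpace ℂ B]

theorem norm_pow_smul_le (Rn : ℕ → B →L[ℂ] B) {z : ℂ} (hz : ‖z‖ ≤ 1) (n : ℕ) :
    ‖z ^ n • Rn n‖ ≤ ‖Rn n‖ := by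
  rw [norm_smul, norm_pow]
  exact mul_le_of_le_one_left (norm_nonneg _) (pow_le_one₀ (norm_nonneg _) hz)

variable [CompleteSpace B]

theorem summable_pow_smul {Rn : ℕ → B →L[ℂ] B} (hsum : Summable fun n => ‖Rn n‖) {z : ℂ}
    (hz : ‖z‖ ≤ 1) : Summable fun n => z ^ n • Rn n :=
  Summable.of_norm_bounded hsum fun n => norm_pow_smul_le Rn hz n

theorem hasSum_Rcal_apply {Rn : ℕ → B →L[ℂ] B} (hsum : Summable fun n => ‖Rn n‖) {z : ℂ}
    (hz : ‖z‖ ≤ 1) (b : B) : HasSum (fun n => z ^ n • Rn n b) (Rcal Rn z b) := by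
  have h : HasSum (fun n => z ^ n • Rn n) (Rcal Rn z) := (summable_pow_smul hsum hz).hasSum
  exact h.mapL (ContinuousLinearMap.apply ℂ B b)

theorem continuousOn_Rcal {Rn : ℕ → B →L[ℂ] B} (hsum : Summable fun n => ‖Rn n‖) :
    ContinuousOn (Rcal Rn) (closedBall 0 1) := by
  refine continuousOn_tsum (u := fun n => ‖Rn n‖) (fun n => by fun_prop) hsum fun n z hz => ?_
  exact norm_pow_smul_le Rn (by simpa using hz) n

theorem differentiableOn_Rcal {Rn : ℕ → B →L[ℂ] B} (hsum : Summable fun n => ‖Rn n‖) :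
    DifferentiableOn ℂ (Rcal Rn) (ball 0 1) := by
  refine Complex.differentiableOn_tsum_of_summable_norm (u := fun n => ‖Rn n‖) hsum
    (fun n => by fun_prop) isOpen_ball fun n z hz => ?_
  exact norm_pow_smul_le Rn (by simpa using (mem_ball_zero_iff.1 hz).le) n

theorem norm_one_sub_pow_le {z : ℂ} (hz : ‖z‖ ≤ 1) (n : ℕ) : ‖1 - z ^ n‖ ≤ n * ‖1 - z‖ := by
  rw [← mul_neg_geom_sum, norm_mul, mul_comm]
  refine mul_le_mul_of_nonneg_right ?_ (norm_nonneg _)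
  refine (norm_sum_le _ _).trans ?_
  calc ∑ i ∈ Finset.range n, ‖z ^ i‖ ≤ ∑ i ∈ Finset.range n, (1 : ℝ) :=
        Finset.sum_le_sum fun i _ => by
          rw [norm_pow]; exact pow_le_one₀ (norm_nonneg _) hz
    _ = n := by simp

/-- The resolvent of a renewal family has a simple pole at `1` up to a smaller order error. -/
theorem norm_inverse_one_sub_Rcal_sub_le {Rn : ℕ → B →L[ℂ] B}
    (hsum : Summable fun n => ‖Rn n‖) (l : B →L[ℂ] ℂ) (one : B)
    (h11 : Rcal Rn 1 one = one) (hl1 : l one = 1) (hlR : ∀ b, l (Rcal Rn 1 b) = l b)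
    {p : ℕ → ℝ} {κ m : ℝ} (hlp : ∀ n b, ‖l (Rn n b)‖ ≤ κ * p n * ‖b‖)
    (hp1 : ∀ n, l (Rn n one) = p n) (hm : HasSum (fun n => n * p n) m) (hm0 : 0 < m)
    (hspec1 : IsUnit (1 - Rcal Rn 1 + l.smulRight one))
    (hspec2 : ∀ z : ℂ, ‖z‖ ≤ 1 → z ≠ 1 → IsUnit (1 - Rcal Rn z)) {ε : ℝ} (hε : 0 < ε) :
    ∃ K : ℝ, ∀ z : ℂ, ‖z‖ < 1 → ∀ b : B,
      ‖Ring.inverse (1 - Rcal Rn z) b - (l b / (m * (1 - z))) • one‖ ≤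
        (ε / ‖1 - z‖ + K) * ‖b‖ := by
  set S : ℂ → B →L[ℂ] B := fun z => 1 - Rcal Rn z + l.smulRight one with hS
  set A : ℂ → B →L[ℂ] B := fun z => Ring.inverse (S z) with hA
  set ψ : ℂ → B → ℂ := fun z b => (l b - l (Rcal Rn z b)) / (1 - z) with hψ
  have h1mem : (1 : ℂ) ∈ closedBall (0 : ℂ) 1 := by simp
  have hScont : ContinuousOn S (closedBall 0 1) :=
    (continuousOn_const.sub (continuousOn_Rcal hsum)).add continuousOn_const
  have hle : 𝓝[ball (0 : ℂ) 1] (1 : ℂ) ≤ 𝓝[closedBall 0 1] 1 :=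
    nhdsWithin_mono _ ball_subset_closedBall
  have hStend : Tendsto S (𝓝[ball (0 : ℂ) 1] 1) (𝓝 (S 1)) := (hScont 1 h1mem).mono_left hle
  have hAtend : Tendsto A (𝓝[ball (0 : ℂ) 1] 1) (𝓝 (A 1)) := by
    have := NormedRing.inverse_continuousAt hspec1.unit
    exact Tendsto.comp this hStend
  have hunit : ∀ᶠ z in 𝓝[ball (0 : ℂ) 1] 1, IsUnit (S z) :=
    hStend.eventually (Units.isOpen.mem_nhds hspec1)
  have hA1 : A 1 one = one := by
    have h1 : S 1 one = one := by simp [hS, h11, hl1]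
    have h2 : (A 1 * S 1) one = one := by
      rw [hA]; simp only; rw [Ring.inverse_mul_cancel _ hspec1]; rfl
    rwa [mul_apply_eq_comp, h1] at h2
  have hAone : Tendsto (fun z => A z one) (𝓝[ball (0 : ℂ) 1] 1) (𝓝 one) := by
    have := ((ContinuousLinearMap.apply ℂ B one).continuous.tendsto (A 1)).comp hAtend
    simpa [Function.comp_def, hA1] using this
  have hψsum : ∀ z : ℂ, ‖z‖ < 1 → ∀ b,
      HasSum (fun n => (1 - z ^ n) / (1 - z) * l (Rn n b)) (ψ z b) := by
    intro z hz b
    have h1 := l.hasSum (hasSum_Rcal_apply hsum (z := 1) (by simp) b)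
    have h2 := l.hasSum (hasSum_Rcal_apply hsum hz.le b)
    rw [hlR] at h1
    refine ((h1.sub h2).div_const (1 - z)).congr_fun fun n => ?_
    simp only [one_pow, one_smul, map_smul, smul_eq_mul]
    ring
  have hκp : ∀ n, 0 ≤ κ * p n * ‖one‖ := fun n => (norm_nonneg _).trans (hlp n one)
  have hone : 0 < ‖one‖ := norm_pos_iff.2 fun h => by simp [h] at hl1
  have hκp' : ∀ n, 0 ≤ κ * p n := fun n => nonneg_of_mul_nonneg_left (hκp n) hone
  have hquot : ∀ z : ℂ, ‖z‖ < 1 → ∀ n : ℕ, ‖(1 - z ^ n) / (1 - z)‖ ≤ n := by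
    intro z hz n
    have hz1 : 0 < ‖1 - z‖ := norm_pos_iff.2 fun h => by
      rw [← sub_eq_zero.1 h] at hz; simp at hz
    rw [norm_div, div_le_iff₀ hz1]
    exact norm_one_sub_pow_le hz.le n
  have hψle : ∀ z : ℂ, ‖z‖ < 1 → ∀ b, ‖ψ z b‖ ≤ κ * m * ‖b‖ := by
    intro z hz b
    rw [← (hψsum z hz b).tsum_eq]
    refine tsum_of_norm_bounded ((hm.mul_left κ).mul_right ‖b‖) fun n => ?_
    rw [norm_mul]
    calc _ ≤ n * (κ * p n * ‖b‖) :=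
          mul_le_mul (hquot z hz n) (hlp n b) (norm_nonneg _) (Nat.cast_nonneg _)
      _ = _ := by ring
  have hψone : Tendsto (fun z => ψ z one) (𝓝[ball (0 : ℂ) 1] 1) (𝓝 (m : ℂ)) := by
    have hmC : HasSum (fun n : ℕ => (n : ℂ) * p n) (m : ℂ) := by
      have := Complex.hasSum_ofReal.2 hm
      simpa using this
    have := tendsto_tsum_of_dominated_convergence (𝓕 := 𝓝[ball (0 : ℂ) 1] 1)
      (f := fun z n => (1 - z ^ n) / (1 - z) * l (Rn n one)) (g := fun n : ℕ => (n : ℂ) * p n)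
      (bound := fun n => κ * (n * p n) * ‖one‖) ((hm.mul_left κ).mul_right ‖one‖).summable
      (fun n => ?_) ?_
    · rw [hmC.tsum_eq] at this
      refine this.congr' ?_
      filter_upwards [self_mem_nhdsWithin] with z hz
      exact (hψsum z (mem_ball_zero_iff.1 hz) one).tsum_eq
    · rw [hp1]
      refine Tendsto.mul_const _ ?_
      have h1 : Tendsto (fun z : ℂ => ∑ i ∈ Finset.range n, z ^ i) (𝓝[ball (0 : ℂ) 1] 1)
          (𝓝 (n : ℂ)) := by
        have : Continuous fun z : ℂ => ∑ i ∈ Finset.range n, z ^ i := by fun_prop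
        have := this.tendsto 1
        simp only [one_pow, Finset.sum_const, Finset.card_range, nsmul_eq_mul, mul_one] at this
        exact this.mono_left nhdsWithin_le_nhds
      refine h1.congr' ?_
      filter_upwards [self_mem_nhdsWithin] with z hz
      have hz1 : 1 - z ≠ 0 := fun h => by
        rw [← sub_eq_zero.1 h] at hz; simp at hz
      rw [eq_div_iff hz1, mul_comm, mul_neg_geom_sum]
    · filter_upwards [self_mem_nhdsWithin] with z hz n
      rw [norm_mul]
      calc _ ≤ n * (κ * p n * ‖one‖) :=
            mul_le_mul (hquot z (mem_ball_zero_iff.1 hz) n) (hlp n one) (norm_nonneg _)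
              (Nat.cast_nonneg _)
        _ = _ := by ring
  set q : ℂ → ℂ := fun z => ψ z (A z one) with hq
  have hqtend : Tendsto q (𝓝[ball (0 : ℂ) 1] 1) (𝓝 (m : ℂ)) := by
    have h1 : Tendsto (fun z => ψ z (A z one - one)) (𝓝[ball (0 : ℂ) 1] 1) (𝓝 0) := by
      have h2 : Tendsto (fun z => κ * m * ‖A z one - one‖) (𝓝[ball (0 : ℂ) 1] 1) (𝓝 0) := by
        have := ((hAone.sub_const one).norm).const_mul (κ * m)
        simpa using this
      refine squeeze_zero_norm' ?_ h2
      filter_upwards [self_mem_nhdsWithin] with z hz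
      exact hψle z (mem_ball_zero_iff.1 hz) _
    have := hψone.add h1
    rw [add_zero] at this
    refine this.congr fun z => ?_
    simp only [hψ, hq, map_sub]
    ring
  set E : ℂ → ℝ := fun z => ‖1 - z‖ * (‖A z‖ + κ * m * ‖A z‖ * ‖(q z)⁻¹‖ * ‖A z one‖) +
    ‖l‖ * ‖(q z)⁻¹ • A z one - (m : ℂ)⁻¹ • one‖ with hE
  have hm0' : (m : ℂ) ≠ 0 := by exact_mod_cast hm0.ne'
  have hqinv := hqtend.inv₀ hm0'
  have hid : Tendsto (fun z : ℂ => z) (𝓝[ball (0 : ℂ) 1] 1) (𝓝 1) :=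
    tendsto_id.mono_left nhdsWithin_le_nhds
  have hEtend : Tendsto E (𝓝[ball (0 : ℂ) 1] 1) (𝓝 0) := by
    have h1 := ((hid.const_sub 1).norm).mul
      (hAtend.norm.add (((hAtend.norm.const_mul (κ * m)).mul hqinv.norm).mul hAone.norm))
    have h2 := (((hqinv.smul hAone).sub_const ((m : ℂ)⁻¹ • one)).norm).const_mul ‖l‖
    have := h1.add h2
    simpa [hE] using this
  have hev := (hEtend.eventually (gt_mem_nhds hε)).and
    (hunit.and (hqtend.eventually_ne hm0'))
  obtain ⟨δ, hδ, hball⟩ := Metric.mem_nhdsWithin_iff.1 hev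
  obtain ⟨K₁, hK₁⟩ : ∃ K₁, ∀ z ∈ closedBall (0 : ℂ) 1 \ ball 1 δ,
      ‖Ring.inverse (1 - Rcal Rn z)‖ ≤ K₁ := by
    refine ((isCompact_closedBall 0 1).diff isOpen_ball).exists_bound_of_continuousOn ?_
    intro z hz
    have hz1 : z ≠ 1 := fun h => hz.2 (h ▸ mem_ball_self hδ)
    have hu := hspec2 z (by simpa using hz.1) hz1
    have h1 := NormedRing.inverse_continuousAt hu.unit
    have h2 : ContinuousWithinAt (fun z => 1 - Rcal Rn z) (closedBall (0 : ℂ) 1 \ ball 1 δ) z :=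
      ((continuousOn_const.sub (continuousOn_Rcal hsum)) z hz.1).mono sdiff_subset
    exact ContinuousAt.comp_continuousWithinAt (f := fun z => 1 - Rcal Rn z) h1 h2
  refine ⟨|K₁| + ‖l‖ * ‖one‖ / (m * δ), fun z hz b => ?_⟩
  have hz1 : z ≠ 1 := fun h => by rw [h] at hz; simp at hz
  have hz1' : 1 - z ≠ 0 := sub_ne_zero.2 (Ne.symm hz1)
  have hpos : 0 < ‖1 - z‖ := norm_pos_iff.2 hz1'
  have hu := hspec2 z hz.le hz1
  set x := Ring.inverse (1 - Rcal Rn z) b with hx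
  by_cases hzδ : z ∈ ball (1 : ℂ) δ
  · obtain ⟨hEz, huz, hqz⟩ := hball ⟨hzδ, mem_ball_zero_iff.2 hz⟩
    have hxb : x - Rcal Rn z x = b := by
      have : ((1 - Rcal Rn z) * Ring.inverse (1 - Rcal Rn z)) b = b := by
        rw [Ring.mul_inverse_cancel _ hu]; rfl
      simpa using this
    have hxA : x = A z b + l x • A z one := by
      have h1 : S z x = b + l x • one := by
        rw [← hxb]
        rfl
      have h2 : (A z * S z) x = x := by
        rw [hA]; simp only; rw [Ring.inverse_mul_cancel _ huz]; rfl
      rw [mul_apply_eq_comp, h1] at h2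
      rw [map_add, map_smul] at h2
      exact h2.symm
    have hψx : (1 - z) * ψ z x = l b := by
      simp only [hψ]
      rw [mul_div_cancel₀ _ hz1', ← map_sub, hxb]
    have hψadd : ψ z x = ψ z (A z b) + l x * q z := by
      conv_lhs => rw [hxA]
      simp only [hψ, hq, map_add, map_smul, smul_eq_mul]
      ring
    have hlx : (1 - z) * l x = (l b - (1 - z) * ψ z (A z b)) * (q z)⁻¹ := by
      rw [eq_mul_inv_iff_mul_eq₀ hqz, ← hψx, hψadd]
      ring
    have hy : (1 - z) • (x - (l b / (m * (1 - z))) • one) =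
        (1 - z) • (A z b - (ψ z (A z b) * (q z)⁻¹) • A z one) +
          l b • ((q z)⁻¹ • A z one - (m : ℂ)⁻¹ • one) := by
      have h1 : (1 - z) • x = (1 - z) • A z b +
          ((l b - (1 - z) * ψ z (A z b)) * (q z)⁻¹) • A z one := by
        rw [← hlx]
        conv_lhs => rw [hxA]
        rw [smul_add, smul_smul]
      have h2 : (1 - z) * (l b / (m * (1 - z))) = l b * (m : ℂ)⁻¹ := by
        field_simp
      rw [smul_sub, h1, smul_smul, h2]
      module
    have hyn : ‖1 - z‖ * ‖x - (l b / (m * (1 - z))) • one‖ ≤ E z * ‖b‖ := by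
      rw [← norm_smul, hy]
      refine (norm_add_le _ _).trans ?_
      rw [norm_smul, norm_smul, hE, add_mul]
      refine add_le_add ?_ ?_
      · rw [mul_assoc]
        refine mul_le_mul_of_nonneg_left ?_ (norm_nonneg _)
        refine (norm_sub_le _ _).trans ?_
        rw [norm_smul, norm_mul, add_mul]
        refine add_le_add ((A z).le_opNorm b) ?_
        have h1 : ‖ψ z (A z b)‖ ≤ κ * m * (‖A z‖ * ‖b‖) := by
          refine (hψle z hz _).trans (mul_le_mul_of_nonneg_left ((A z).le_opNorm b) ?_)
          exact nonneg_of_mul_nonneg_left ((norm_nonneg _).trans (hψle z hz one)) hone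
        calc _ ≤ κ * m * (‖A z‖ * ‖b‖) * ‖(q z)⁻¹‖ * ‖A z one‖ := by gcongr
          _ = _ := by ring
      · calc _ ≤ ‖l‖ * ‖b‖ * ‖(q z)⁻¹ • A z one - (m : ℂ)⁻¹ • one‖ := by
              gcongr; exact l.le_opNorm b
          _ = _ := by ring
    have h3 : ‖x - (l b / (m * (1 - z))) • one‖ ≤ ε / ‖1 - z‖ * ‖b‖ := by
      rw [div_mul_eq_mul_div, le_div_iff₀ hpos, mul_comm]
      exact hyn.trans (mul_le_mul_of_nonneg_right (le_of_lt hEz) (norm_nonneg _))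
    refine h3.trans (mul_le_mul_of_nonneg_right ?_ (norm_nonneg _))
    have : 0 ≤ |K₁| + ‖l‖ * ‖one‖ / (m * δ) := by positivity
    linarith
  · have hδz : δ ≤ ‖1 - z‖ := by
      rw [mem_ball, not_lt, dist_comm, dist_eq_norm] at hzδ
      exact hzδ
    have h1 := hK₁ z ⟨by simpa using hz.le, hzδ⟩
    have h2 : ‖x‖ ≤ |K₁| * ‖b‖ :=
      (ContinuousLinearMap.le_opNorm _ b).trans
        (mul_le_mul_of_nonneg_right (h1.trans (le_abs_self _)) (norm_nonneg _))
    have h3 : ‖(l b / (m * (1 - z))) • one‖ ≤ ‖l‖ * ‖one‖ / (m * δ) * ‖b‖ := by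
      rw [norm_smul, norm_div, norm_mul, Complex.norm_real, Real.norm_of_nonneg hm0.le]
      calc _ ≤ (‖l‖ * ‖b‖) / (m * δ) * ‖one‖ := by
            gcongr
            exact l.le_opNorm b
        _ = _ := by ring
    have h4 : 0 ≤ ε / ‖1 - z‖ * ‖b‖ := by positivity
    calc _ ≤ ‖x‖ + ‖(l b / (m * (1 - z))) • one‖ := norm_sub_le _ _
      _ ≤ |K₁| * ‖b‖ + ‖l‖ * ‖one‖ / (m * δ) * ‖b‖ := add_le_add h2 h3
      _ ≤ _ := by rw [add_mul, add_mul]; linarith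

end Resolvent

section RenewalCoefficients

variable {B : Type} [NormedAddCommGroup B] [NormedSpace ℂ B]

theorem coeff_eq_of_hasSum {E : Type*} [NormedAddCommGroup E] [NormedSpace ℂ E] {a c : ℕ → E}
    {G : ℂ → E} (ha : ∀ z : ℂ, ‖z‖ < 1 → HasSum (fun n => z ^ n • a n) (G z))
    (hc : ∀ z : ℂ, ‖z‖ < 1 → HasSum (fun n => z ^ n • c n) (G z)) : a = c := by
  have key : ∀ a : ℕ → E, (∀ z : ℂ, ‖z‖ < 1 → HasSum (fun n => z ^ n • a n) (G z)) →
      HasFPowerSeriesAt G (fun n => ContinuousMultilinearMap.mkPiRing ℂ (Fin n) (a n) :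
        FormalMultilinearSeries ℂ ℂ E) 0 := by
    intro a ha
    refine hasFPowerSeriesAt_iff.2 ?_
    filter_upwards [ball_mem_nhds (0 : ℂ) one_pos] with z hz
    simpa [FormalMultilinearSeries.coeff] using ha z (mem_ball_zero_iff.1 hz)
  have h := (key a ha).eq_formalMultilinearSeries (key c hc)
  funext n
  have := congrArg (fun p => FormalMultilinearSeries.coeff p n) h
  simpa [FormalMultilinearSeries.coeff] using this

variable [CompleteSpace B]

/-- Coefficients of the resolvent `(1 - R(z))⁻¹` of a renewal family and the renewal equation
they satisfy. -/
theorem exists_renewal_coeff {Rn : ℕ → B →L[ℂ] B} (hsum : Summable fun n => ‖Rn n‖)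
    (hspec : ∀ z : ℂ, ‖z‖ < 1 → IsUnit (1 - Rcal Rn z)) :
    ∃ Tn : ℕ → B →L[ℂ] B,
      (∀ n, Tn n = (if n = 0 then 1 else 0) +
        ∑ p ∈ Finset.HasAntidiagonal.antidiagonal n, Tn p.1 * Rn p.2) ∧
      (∀ z : ℂ, ‖z‖ < 1 → HasSum (fun n => z ^ n • Tn n) (Ring.inverse (1 - Rcal Rn z))) ∧
      ∀ r : ℝ, 0 ≤ r → r < 1 → Summable fun n => r ^ n * ‖Tn n‖ := by
  set f : ℂ → B →L[ℂ] B := fun z => Ring.inverse (1 - Rcal Rn z) with hf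
  have hdiff : DifferentiableOn ℂ f (ball 0 1) := by
    intro z hz
    have h1 : DifferentiableWithinAt ℂ (fun z => 1 - Rcal Rn z) (ball 0 1) z :=
      (differentiableWithinAt_const _).sub (differentiableOn_Rcal hsum z hz)
    have h2 := differentiableAt_inverse (𝕜 := ℂ) (hspec z (mem_ball_zero_iff.1 hz)).unit.isUnit
    exact DifferentiableAt.comp_differentiableWithinAt z h2 h1
  set Tn : ℕ → B →L[ℂ] B := fun n => ((n.factorial : ℂ))⁻¹ • iteratedDeriv n f 0 with hTn
  have hT : ∀ z : ℂ, ‖z‖ < 1 → HasSum (fun n => z ^ n • Tn n) (f z) := by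
    intro z hz
    have := Complex.hasSum_taylorSeries_on_ball (r := 1) hdiff
      (show z ∈ ball (0 : ℂ) ((1 : ℝ≥0) : ℝ) by simpa using hz)
    refine this.congr_fun fun n => ?_
    simp only [hTn, sub_zero, smul_smul]
    rw [mul_comm]
  have hTs : ∀ r : ℝ, 0 ≤ r → r < 1 → Summable fun n => r ^ n * ‖Tn n‖ := by
    intro r hr0 hr1
    obtain ⟨s, hrs, hs1⟩ := exists_between hr1
    have hs0 : 0 < s := hr0.trans_lt hrs
    have h1 := (hT (s : ℂ) (by rwa [Complex.norm_real, Real.norm_of_nonneg hs0.le])).summable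
    have h2 := h1.tendsto_atTop_zero.norm
    obtain ⟨K, hK⟩ := h2.bddAbove_range
    refine Summable.of_nonneg_of_le (fun n => by positivity) (fun n => ?_)
      ((summable_geometric_of_lt_one (div_nonneg hr0 hs0.le) ((div_lt_one hs0).2 hrs)).mul_left K)
    have h3 : ‖(s : ℂ) ^ n • Tn n‖ ≤ K := hK ⟨n, rfl⟩
    rw [norm_smul, norm_pow, Complex.norm_real, Real.norm_of_nonneg hs0.le] at h3
    calc r ^ n * ‖Tn n‖ = s ^ n * ‖Tn n‖ * (r / s) ^ n := by
          rw [div_pow]; field_simp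
      _ ≤ K * (r / s) ^ n := mul_le_mul_of_nonneg_right h3 (by positivity)
  refine ⟨Tn, ?_, hT, hTs⟩
  have h1 : ∀ z : ℂ, ‖z‖ < 1 → HasSum
      (fun n => z ^ n • ∑ p ∈ Finset.HasAntidiagonal.antidiagonal n, Tn p.1 * Rn p.2)
      (f z * Rcal Rn z) := by
    intro z hz
    have hs1 : Summable fun n => ‖z ^ n • Tn n‖ := by
      refine (hTs ‖z‖ (norm_nonneg _) hz).congr fun n => ?_
      exact (by rw [norm_smul, norm_pow] : ‖z ^ n • Tn n‖ = ‖z‖ ^ n * ‖Tn n‖).symm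
    have hs2 : Summable fun n => ‖z ^ n • Rn n‖ :=
      Summable.of_nonneg_of_le (fun _ => norm_nonneg _) (norm_pow_smul_le Rn hz.le) hsum
    have h := (summable_norm_sum_mul_antidiagonal_of_summable_norm hs1 hs2).of_norm.hasSum
    rw [← tsum_mul_tsum_eq_tsum_sum_antidiagonal_of_summable_norm hs1 hs2, (hT z hz).tsum_eq]
      at h
    refine h.congr_fun fun n => ?_
    rw [Finset.smul_sum]
    refine Finset.sum_congr rfl fun p hp => ?_
    rw [← Finset.HasAntidiagonal.mem_antidiagonal.1 hp, pow_add, smul_mul_smul_comm]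
  have h2 : ∀ z : ℂ, ‖z‖ < 1 → HasSum
      (fun n => z ^ n • (Tn n - if n = 0 then 1 else 0)) (f z * Rcal Rn z) := by
    intro z hz
    have h3 : f z * Rcal Rn z = f z - 1 := by
      have := Ring.inverse_mul_cancel _ (hspec z hz)
      rw [mul_sub, mul_one] at this
      rw [← this, hf]
      abel
    rw [h3]
    have h4 : HasSum (fun n : ℕ => z ^ n • (if n = 0 then 1 else 0 : B →L[ℂ] B)) 1 := by
      have := hasSum_single (f := fun n : ℕ => z ^ n • (if n = 0 then 1 else 0 : B →L[ℂ] B)) 0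
        (fun n hn => by simp [hn])
      simpa using this
    refine ((hT z hz).sub h4).congr_fun fun n => ?_
    rw [smul_sub]
  intro n
  rw [congrFun (coeff_eq_of_hasSum h1 h2) n]
  abel

end RenewalCoefficients

section Pairing

variable {X : Type} [MeasurableSpace X]

/-- Bounded measurable complex functions. -/
def IsBddMeasurable (h : X → ℂ) : Prop :=
  Measurable h ∧ ∃ c, ∀ x, ‖h x‖ ≤ c

namespace IsBddMeasurable

variable {h g : X → ℂ}

theorem comp (hh : IsBddMeasurable h) {f : X → X} (hf : Measurable f) :
    IsBddMeasurable fun x => h (f x) :=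
  ⟨hh.1.comp hf, hh.2.imp fun _ hc x => hc (f x)⟩

theorem indicator (hh : IsBddMeasurable h) {s : Set X} (hs : MeasurableSet s) :
    IsBddMeasurable (s.indicator h) :=
  ⟨hh.1.indicator hs, hh.2.imp fun _ hc x => (norm_indicator_le_norm_self h x).trans (hc x)⟩

theorem add (hh : IsBddMeasurable h) (hg : IsBddMeasurable g) :
    IsBddMeasurable fun x => h x + g x := by
  obtain ⟨c, hc⟩ := hh.2
  obtain ⟨d, hd⟩ := hg.2
  exact ⟨hh.1.add hg.1, c + d, fun x => (norm_add_le _ _).trans (add_le_add (hc x) (hd x))⟩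

theorem mul (hh : IsBddMeasurable h) (hg : IsBddMeasurable g) :
    IsBddMeasurable fun x => h x * g x := by
  obtain ⟨c, hc⟩ := hh.2
  obtain ⟨d, hd⟩ := hg.2
  refine ⟨hh.1.mul hg.1, c * d, fun x => ?_⟩
  rw [norm_mul]
  exact mul_le_mul (hc x) (hd x) (norm_nonneg _) ((norm_nonneg _).trans (hc x))

theorem const (c : ℂ) : IsBddMeasurable fun _ : X => c :=
  ⟨measurable_const, ‖c‖, fun _ => le_rfl⟩

theorem sum {α : Type*} (s : Finset α) {f : α → X → ℂ} (hf : ∀ a ∈ s, IsBddMeasurable (f a)) :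
    IsBddMeasurable fun x => ∑ a ∈ s, f a x := by
  classical
  induction s using Finset.induction_on with
  | empty => simpa using const (X := X) 0
  | insert a s ha ih =>
    simp only [Finset.sum_insert ha]
    exact (hf a (Finset.mem_insert_self a s)).add
      (ih fun b hb => hf b (Finset.mem_insert_of_mem hb))

theorem integrable (hh : IsBddMeasurable h) (μ : Measure X) [IsFiniteMeasure μ] :
    Integrable h μ :=
  .of_bound hh.1.aestronglyMeasurable hh.2.choose (ae_of_all _ hh.2.choose_spec)

theorem integrable_mul (hh : IsBddMeasurable h) {μ : Measure X} {f : X → ℂ}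
    (hf : Integrable f μ) : Integrable (fun x => f x * h x) μ :=
  hf.mul_bdd (c := hh.2.choose) hh.1.aestronglyMeasurable (ae_of_all _ hh.2.choose_spec)

end IsBddMeasurable

variable {B : Type} [NormedAddCommGroup B] [NormedSpace ℂ B]
variable {μ : Measure X} {φ : X → ℕ} {F T : X → X} {ι : B →L[ℂ] Lp ℂ 1 μ} {Rn Tn : ℕ → B →L[ℂ] B}
  {κ : ℝ}

/-- The integral of `ι b` against `h`. -/
def pairing (ι : B →L[ℂ] Lp ℂ 1 μ) (h : X → ℂ) (b : B) : ℂ :=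
  ∫ x, (ι b : X → ℂ) x * h x ∂μ

theorem isLinearMap_pairing {h : X → ℂ} (hh : IsBddMeasurable h) :
    IsLinearMap ℂ (pairing ι h) where
  map_add b c := by
    rw [pairing, pairing, pairing, ← integral_add (hh.integrable_mul (L1.integrable_coeFn _))
      (hh.integrable_mul (L1.integrable_coeFn _))]
    refine integral_congr_ae ?_
    rw [map_add]
    filter_upwards [Lp.coeFn_add (ι b) (ι c)] with x hx
    rw [hx, Pi.add_apply, add_mul]
  map_smul a b := by
    rw [pairing, pairing, smul_eq_mul, ← integral_const_mul]
    refine integral_congr_ae ?_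
    rw [map_smul]
    filter_upwards [Lp.coeFn_smul a (ι b)] with x hx
    rw [hx, Pi.smul_apply, smul_eq_mul, mul_assoc]

theorem pairing_sum_right {α : Type*} (s : Finset α) {f : α → X → ℂ}
    (hf : ∀ a ∈ s, IsBddMeasurable (f a)) (b : B) :
    pairing ι (fun x => ∑ a ∈ s, f a x) b = ∑ a ∈ s, pairing ι (f a) b := by
  simp only [pairing, Finset.mul_sum]
  exact integral_finsetSum s fun a ha => (hf a ha).integrable_mul (L1.integrable_coeFn _)

theorem pairing_add_right {h g : X → ℂ} (hh : IsBddMeasurable h) (hg : IsBddMeasurable g)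
    (b : B) : pairing ι (fun x => h x + g x) b = pairing ι h b + pairing ι g b := by
  simp only [pairing, mul_add]
  exact integral_add (hh.integrable_mul (L1.integrable_coeFn _))
    (hg.integrable_mul (L1.integrable_coeFn _))

theorem norm_pairing_le [IsFiniteMeasure μ]
    (hembed : ∀ b : B, ∀ᵐ x ∂μ, ‖(ι b : X → ℂ) x‖ ≤ κ * ‖b‖)
    {h : X → ℂ} (hh : IsBddMeasurable h) (b : B) :
    ‖pairing ι h b‖ ≤ κ * ‖b‖ * ∫ x, ‖h x‖ ∂μ := by
  rw [← integral_const_mul]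
  refine norm_integral_le_of_norm_le ((hh.integrable μ).norm.const_mul _) ?_
  filter_upwards [hembed b] with x hx
  rw [norm_mul]
  exact mul_le_mul_of_nonneg_right hx (norm_nonneg _)

/-- The operators `Rₙ = R(1_{φ=n} ·)` acting on functions in the range of `ι`, where `R` is the
transfer operator of `F`. -/
structure IsReturnFamily (φ : X → ℕ) (F : X → X) (ι : B →L[ℂ] Lp ℂ 1 μ)
    (Rn : ℕ → B →L[ℂ] B) (κ : ℝ) : Prop where
  measurable_time : Measurable φ
  one_le_time : ∀ x, 1 ≤ φ x
  measurePreserving : MeasurePreserving F μ μ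
  zero : Rn 0 = 0
  pairing_apply : ∀ p b (h : X → ℂ), IsBddMeasurable h →
    pairing ι h (Rn p b) = pairing ι ({x | φ x = p}.indicator fun x => h (F x)) b
  bound : ∀ b : B, ∀ᵐ x ∂μ, ‖(ι b : X → ℂ) x‖ ≤ κ * ‖b‖

/-- The coefficients of the formal inverse of `1 - ∑ Rₙ zⁿ`. -/
def IsRenewalSeq (Rn Tn : ℕ → B →L[ℂ] B) : Prop :=
  ∀ n, Tn n = (if n = 0 then 1 else 0) +
    ∑ p ∈ Finset.HasAntidiagonal.antidiagonal n, Tn p.1 * Rn p.2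

theorem IsRenewalSeq.apply (hT : IsRenewalSeq Rn Tn) (n : ℕ) (b : B) :
    Tn n b = (if n = 0 then b else 0) +
      ∑ p ∈ Finset.HasAntidiagonal.antidiagonal n, Tn p.1 (Rn p.2 b) := by
  conv_lhs => rw [hT n]
  rw [add_apply, sum_apply]
  congr 1
  split_ifs <;> rfl

theorem IsRenewalSeq.sum_antidiagonal_eq (hT : IsRenewalSeq Rn Tn) (hR : Rn 0 = 0)
    {A W : ℕ → B →ₗ[ℂ] ℂ}
    (hA : ∀ m b, A m b = W m b +
      ∑ p ∈ Finset.HasAntidiagonal.antidiagonal m, A p.1 (Rn p.2 b)) (m : ℕ) (b : B) :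
    A m b = ∑ p ∈ Finset.HasAntidiagonal.antidiagonal m, W p.2 (Tn p.1 b) := by
  induction m using Nat.strong_induction_on generalizing b with
  | _ m ih =>
    have h1 : ∀ p ∈ Finset.HasAntidiagonal.antidiagonal m, A p.1 (Rn p.2 b) =
        ∑ q ∈ Finset.HasAntidiagonal.antidiagonal p.1, W q.2 (Tn q.1 (Rn p.2 b)) := by
      intro p hp
      have hpm := Finset.HasAntidiagonal.mem_antidiagonal.1 hp
      rcases Nat.eq_zero_or_pos p.2 with h0 | h0
      · simp [h0, hR]
      · exact ih p.1 (by omega) _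
    have h2 : ∀ p ∈ Finset.HasAntidiagonal.antidiagonal m, W p.2 (Tn p.1 b) =
        W p.2 (if p.1 = 0 then b else 0) +
          ∑ q ∈ Finset.HasAntidiagonal.antidiagonal p.1, W p.2 (Tn q.1 (Rn q.2 b)) := by
      intro p _
      rw [hT.apply, map_add, map_sum]
    rw [hA, Finset.sum_congr rfl h1, Finset.sum_congr rfl h2, Finset.sum_add_distrib]
    congr 1
    · rw [Finset.sum_eq_single (0, m)]
      · simp
      · intro p hp hne
        have hpm := Finset.HasAntidiagonal.mem_antidiagonal.1 hp
        have : p.1 ≠ 0 := fun h0 => hne (Prod.ext h0 (by simp; omega))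
        simp [this]
      · simp
    · rw [Finset.sum_sigma', Finset.sum_sigma']
      refine Finset.sum_nbij' (fun x => ⟨(x.2.1 + x.1.2, x.2.2), (x.2.1, x.1.2)⟩)
        (fun x => ⟨(x.2.1 + x.1.2, x.2.2), (x.2.1, x.1.2)⟩) ?_ ?_ ?_ ?_ ?_
      all_goals
        rintro ⟨⟨a, c⟩, ⟨d, e⟩⟩ h
        simp only [Finset.mem_sigma, Finset.HasAntidiagonal.mem_antidiagonal] at h ⊢
      · exact ⟨by omega, trivial⟩
      · exact ⟨by omega, trivial⟩
      · obtain ⟨h1, h2⟩ := h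
        subst h2
        rfl
      · obtain ⟨h1, h2⟩ := h
        subst h2
        rfl

theorem IsReturnFamily.pairing_iterate (hRn : IsReturnFamily φ F ι Rn κ)
    (hTn : IsRenewalSeq Rn Tn) (hT : Measurable T) (hF : ∀ x, F x = T^[φ x] x) {w : X → ℂ}
    (hw : IsBddMeasurable w) (m : ℕ) (b : B) :
    pairing ι (fun x => w (T^[m] x)) b = ∑ p ∈ Finset.HasAntidiagonal.antidiagonal m,
      pairing ι ({x | p.2 < φ x}.indicator fun x => w (T^[p.2] x)) (Tn p.1 b) := by
  have hwT : ∀ n, IsBddMeasurable fun x => w (T^[n] x) := fun n => hw.comp (hT.iterate n)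
  have hgt : ∀ n, MeasurableSet {x | n < φ x} := fun n =>
    measurableSet_lt measurable_const hRn.measurable_time
  have heq : ∀ n, MeasurableSet {x | φ x = n} := fun n =>
    measurableSet_eq_fun hRn.measurable_time measurable_const
  refine hTn.sum_antidiagonal_eq hRn.zero
    (A := fun m => (isLinearMap_pairing (hwT m)).mk' _)
    (W := fun m => (isLinearMap_pairing ((hwT m).indicator (hgt m))).mk' _) ?_ m b
  intro m b
  simp only [IsLinearMap.mk'_apply]
  have hpt : (fun x => w (T^[m] x)) = fun x =>
      ({x | m < φ x}.indicator (fun x => w (T^[m] x)) x) +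
        ∑ p ∈ Finset.HasAntidiagonal.antidiagonal m,
          {x | φ x = p.2}.indicator (fun x => w (T^[p.1] (F x))) x := by
    funext x
    rcases lt_or_ge m (φ x) with h | h
    · rw [indicator_of_mem (show x ∈ {x | m < φ x} from h), Finset.sum_eq_zero, add_zero]
      intro p hp
      have hpm := Finset.HasAntidiagonal.mem_antidiagonal.1 hp
      have hx : x ∉ {x | φ x = p.2} := fun hx : φ x = p.2 => by omega
      exact indicator_of_notMem hx _
    · rw [indicator_of_notMem (show x ∉ {x | m < φ x} from not_lt.2 h), zero_add,
        Finset.sum_eq_single (m - φ x, φ x)]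
      · rw [indicator_of_mem (show x ∈ {y | φ y = φ x} from rfl), hF,
          ← Function.iterate_add_apply, Nat.sub_add_cancel h]
      · intro p hp hne
        have hpm := Finset.HasAntidiagonal.mem_antidiagonal.1 hp
        have hx : x ∉ {x | φ x = p.2} := fun hx : φ x = p.2 =>
          hne (Prod.ext (by simp only; omega) hx.symm)
        exact indicator_of_notMem hx _
      · intro hn
        exact absurd (Finset.HasAntidiagonal.mem_antidiagonal.2 (Nat.sub_add_cancel h)) hn
  have hb2 : ∀ p ∈ Finset.HasAntidiagonal.antidiagonal m,
      IsBddMeasurable ({x | φ x = p.2}.indicator fun x => w (T^[p.1] (F x))) := fun p _ =>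
    ((hwT p.1).comp hRn.measurePreserving.measurable).indicator (heq p.2)
  conv_lhs => rw [hpt]
  rw [pairing_add_right ((hwT m).indicator (hgt m)) (.sum _ hb2), pairing_sum_right _ hb2]
  congr 1
  exact Finset.sum_congr rfl fun p _ => (hRn.pairing_apply p.2 b _ (hwT p.1)).symm

end Pairing

section RenewalLift

variable {X : Type}

/-- The value of `h` at the iterate of `F` whose accumulated time `φ` is exactly `j`, and zero
if there is none. -/
def renewalLift (φ : X → ℕ) (F : X → X) (h : X → ℂ) (j : ℕ) (x : X) : ℂ :=
  if _hc : 1 ≤ φ x ∧ φ x ≤ j then renewalLift φ F h (j - φ x) (F x)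
  else if j = 0 then h x else 0
termination_by j
decreasing_by omega

variable {φ : X → ℕ} {F : X → X}

theorem renewalLift_zero (hφ : ∀ x, 1 ≤ φ x) (h : X → ℂ) (x : X) :
    renewalLift φ F h 0 x = h x := by
  have := hφ x
  rw [renewalLift, dif_neg (by omega), if_pos rfl]

theorem renewalLift_succ (hφ : ∀ x, 1 ≤ φ x) (h : X → ℂ) (j : ℕ) (x : X) :
    renewalLift φ F h (j + 1) x = ∑ p ∈ Finset.HasAntidiagonal.antidiagonal j,
      {x | φ x = p.2 + 1}.indicator (fun x => renewalLift φ F h p.1 (F x)) x := by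
  have h1 := hφ x
  rw [renewalLift]
  by_cases hc : 1 ≤ φ x ∧ φ x ≤ j + 1
  · rw [dif_pos hc, Finset.sum_eq_single (j + 1 - φ x, φ x - 1)]
    · rw [indicator_of_mem]
      simp only [mem_ofPred_eq]
      omega
    · intro p hp hne
      have hpm := Finset.HasAntidiagonal.mem_antidiagonal.1 hp
      have hx : x ∉ {x | φ x = p.2 + 1} := fun hx : φ x = p.2 + 1 =>
        hne (Prod.ext (by simp only; omega) (by simp only; omega))
      exact indicator_of_notMem hx _
    · intro hn
      exact absurd (Finset.HasAntidiagonal.mem_antidiagonal.2 (by simp only; omega)) hn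
  · rw [dif_neg hc, if_neg j.succ_ne_zero]
    symm
    refine Finset.sum_eq_zero fun p hp => ?_
    have hpm := Finset.HasAntidiagonal.mem_antidiagonal.1 hp
    have hx : x ∉ {x | φ x = p.2 + 1} := fun hx : φ x = p.2 + 1 => by omega
    exact indicator_of_notMem hx _

variable [MeasurableSpace X] {B : Type} [NormedAddCommGroup B] [NormedSpace ℂ B]
variable {μ : Measure X} {ι : B →L[ℂ] Lp ℂ 1 μ} {Rn Tn : ℕ → B →L[ℂ] B} {κ : ℝ}

namespace IsReturnFamily

theorem isBddMeasurable_renewalLift (hRn : IsReturnFamily φ F ι Rn κ) {h : X → ℂ}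
    (hh : IsBddMeasurable h) (j : ℕ) : IsBddMeasurable (renewalLift φ F h j) := by
  induction j using Nat.strong_induction_on with
  | _ j ih =>
    cases j with
    | zero =>
      rwa [show renewalLift φ F h 0 = h from funext (renewalLift_zero hRn.one_le_time h)]
    | succ j =>
      rw [funext (renewalLift_succ hRn.one_le_time h j)]
      refine .sum _ fun p hp => ?_
      have hpm := Finset.HasAntidiagonal.mem_antidiagonal.1 hp
      exact ((ih p.1 (by omega)).comp hRn.measurePreserving.measurable).indicator
        (measurableSet_eq_fun hRn.measurable_time measurable_const)

theorem pairing_renewal (hRn : IsReturnFamily φ F ι Rn κ) (hTn : IsRenewalSeq Rn Tn) {h : X → ℂ}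
    (hh : IsBddMeasurable h) (j : ℕ) (b : B) :
    pairing ι h (Tn j b) = pairing ι (renewalLift φ F h j) b := by
  have hlin := isLinearMap_pairing (ι := ι) hh
  induction j using Nat.strong_induction_on generalizing b with
  | _ j ih =>
    cases j with
    | zero =>
      rw [hTn.apply, show renewalLift φ F h 0 = h from
        funext (renewalLift_zero hRn.one_le_time h)]
      simp [hRn.zero]
    | succ j =>
      rw [funext (renewalLift_succ hRn.one_le_time h j), pairing_sum_right, hTn.apply,
        Finset.Nat.sum_antidiagonal_succ']
      · simp only [hRn.zero, zero_apply, map_zero, zero_add, Nat.succ_ne_zero, if_false]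
        rw [← hlin.mk'_apply, map_sum]
        refine Finset.sum_congr rfl fun p hp => ?_
        have hpm := Finset.HasAntidiagonal.mem_antidiagonal.1 hp
        rw [hlin.mk'_apply, ih p.1 (by omega), hRn.pairing_apply _ _ _
          (hRn.isBddMeasurable_renewalLift hh p.1)]
      · intro p _
        exact ((hRn.isBddMeasurable_renewalLift hh p.1).comp
          hRn.measurePreserving.measurable).indicator
          (measurableSet_eq_fun hRn.measurable_time measurable_const)

theorem integral_norm_renewalLift_le [IsFiniteMeasure μ] (hRn : IsReturnFamily φ F ι Rn κ)
    {h : X → ℂ} (hh : IsBddMeasurable h) (j : ℕ) :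
    ∫ x, ‖renewalLift φ F h j x‖ ∂μ ≤ ∫ x, ‖h x‖ ∂μ := by
  set H := renewalLift φ F h with hH
  have hbm := hRn.isBddMeasurable_renewalLift hh
  have hint : ∀ i, Integrable (fun x => ‖H i (F x)‖) μ := fun i =>
    (((hbm i).comp hRn.measurePreserving.measurable).integrable μ).norm
  have hmp : ∀ i, ∫ x, ‖H i (F x)‖ ∂μ = ∫ x, ‖H i x‖ ∂μ := fun i => by
    have := integral_map (μ := μ) hRn.measurePreserving.measurable.aemeasurable
      (f := fun x => ‖H i x‖) (by
        rw [hRn.measurePreserving.map_eq]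
        exact (hbm i).1.norm.aestronglyMeasurable)
    rw [← this, hRn.measurePreserving.map_eq]
  have hgt : ∀ n, MeasurableSet {x | n < φ x} := fun n =>
    measurableSet_lt measurable_const hRn.measurable_time
  have heq : ∀ n, MeasurableSet {x | φ x = n} := fun n =>
    measurableSet_eq_fun hRn.measurable_time measurable_const
  have hall : {x | 0 < φ x} = univ := eq_univ_of_forall hRn.one_le_time
  have hstep : ∀ j, ∫ x, ‖H (j + 1) x‖ ∂μ ≤
      ∑ p ∈ Finset.HasAntidiagonal.antidiagonal j,
        ∫ x in {x | φ x = p.2 + 1}, ‖H p.1 (F x)‖ ∂μ := by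
    intro j
    calc ∫ x, ‖H (j + 1) x‖ ∂μ ≤ ∫ x, ∑ p ∈ Finset.HasAntidiagonal.antidiagonal j,
          {x | φ x = p.2 + 1}.indicator (fun x => ‖H p.1 (F x)‖) x ∂μ := by
          refine integral_mono ((hbm _).integrable μ).norm
            (integrable_finsetSum _ fun p _ => (hint p.1).indicator (heq _)) fun x => ?_
          simp only [hH]
          rw [renewalLift_succ hRn.one_le_time]
          refine (norm_sum_le _ _).trans_eq (Finset.sum_congr rfl fun p _ => ?_)
          rw [norm_indicator_eq_indicator_norm]
      _ = _ := by
          rw [integral_finsetSum _ fun p _ => (hint p.1).indicator (heq _)]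
          exact Finset.sum_congr rfl fun p _ => integral_indicator (heq _)
  set D : ℕ → ℝ := fun j => ∑ p ∈ Finset.HasAntidiagonal.antidiagonal j,
    ∫ x in {x | p.2 < φ x}, ‖H p.1 (F x)‖ ∂μ with hD
  have hDanti : ∀ j, D (j + 1) ≤ D j := by
    intro j
    simp only [hD]
    rw [Finset.Nat.sum_antidiagonal_succ']
    simp only [hall, setIntegral_univ]
    rw [hmp]
    refine (add_le_add_left (hstep j) _).trans_eq ?_
    rw [← Finset.sum_add_distrib]
    refine Finset.sum_congr rfl fun p _ => ?_
    rw [← setIntegral_union _ (hgt _) (hint p.1).integrableOn (hint p.1).integrableOn]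
    · congr 2
      ext x
      simp only [mem_union, mem_ofPred_eq]
      omega
    · rw [Set.disjoint_left]
      intro x h1 h2
      simp only [mem_ofPred_eq] at h1 h2
      omega
  have hD0 : D 0 = ∫ x, ‖h x‖ ∂μ := by
    simp only [hD, Finset.Nat.antidiagonal_zero, Finset.sum_singleton, hall, setIntegral_univ]
    rw [hmp]
    simp only [hH, renewalLift_zero hRn.one_le_time]
  have hDle : D j ≤ ∫ x, ‖h x‖ ∂μ := hD0 ▸ antitone_nat_of_succ_le hDanti (Nat.zero_le j)
  refine le_trans ?_ hDle
  have := Finset.single_le_sum (f := fun p : ℕ × ℕ => ∫ x in {x | p.2 < φ x}, ‖H p.1 (F x)‖ ∂μ)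
    (fun p _ => integral_nonneg fun _ => norm_nonneg _)
    (Finset.HasAntidiagonal.mem_antidiagonal.2 (add_zero j) : (j, 0) ∈ _)
  simp only [hall, setIntegral_univ] at this
  rwa [hmp] at this

theorem norm_pairing_renewal_le [IsFiniteMeasure μ] (hRn : IsReturnFamily φ F ι Rn κ)
    (hκ : 0 ≤ κ) (hTn : IsRenewalSeq Rn Tn) {h : X → ℂ} (hh : IsBddMeasurable h) (j : ℕ) (b : B) :
    ‖pairing ι h (Tn j b)‖ ≤ κ * ‖b‖ * ∫ x, ‖h x‖ ∂μ := by
  rw [hRn.pairing_renewal hTn hh]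
  refine (norm_pairing_le hRn.bound (hRn.isBddMeasurable_renewalLift hh j) b).trans ?_
  exact mul_le_mul_of_nonneg_left (hRn.integral_norm_renewalLift_le hh j) (by positivity)

end IsReturnFamily

end RenewalLift

section RenewalTheorem

variable {X : Type} [MeasurableSpace X]
variable {B : Type} [NormedAddCommGroup B] [NormedSpace ℂ B]
variable {μ : Measure X} {φ : X → ℕ} {F T : X → X} {ι : B →L[ℂ] Lp ℂ 1 μ} {Rn Tn : ℕ → B →L[ℂ] B}
  {κ : ℝ}

/-- A bounded operator into `L²` representing an embedding with values in `L^∞`. -/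
theorem exists_continuousLinearMap_Lp_two [IsFiniteMeasure μ] (hκ : 0 ≤ κ)
    (hembed : ∀ b : B, ∀ᵐ x ∂μ, ‖(ι b : X → ℂ) x‖ ≤ κ * ‖b‖) :
    ∃ J : B →L[ℂ] Lp ℂ 2 μ, ∀ b, ⇑(J b) =ᵐ[μ] ⇑(ι b) := by
  have hmem : ∀ b, MemLp (ι b : X → ℂ) 2 μ := fun b =>
    .of_bound (Lp.aestronglyMeasurable _) _ (hembed b)
  let J₀ : B →ₗ[ℂ] Lp ℂ 2 μ :=
    { toFun := fun b => (hmem b).toLp _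
      map_add' := fun b c => by
        refine Lp.ext ?_
        filter_upwards [(hmem (b + c)).coeFn_toLp, Lp.coeFn_add (ι b) (ι c), (hmem b).coeFn_toLp,
          (hmem c).coeFn_toLp, Lp.coeFn_add ((hmem b).toLp _) ((hmem c).toLp _)]
          with x h1 h2 h3 h4 h5
        rw [h1, h5, map_add, h2, Pi.add_apply, Pi.add_apply, h3, h4]
      map_smul' := fun a b => by
        refine Lp.ext ?_
        filter_upwards [(hmem (a • b)).coeFn_toLp, Lp.coeFn_smul a (ι b),
          Lp.coeFn_smul a ((hmem b).toLp _), (hmem b).coeFn_toLp] with x h1 h2 h3 h4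
        rw [h1, map_smul, h2, RingHom.id_apply, h3, Pi.smul_apply, Pi.smul_apply, h4] }
  refine ⟨J₀.mkContinuous ((measureUnivNNReal μ : ℝ) ^ (2 : ℝ≥0∞).toReal⁻¹ * κ) fun b => ?_,
    fun b => (hmem b).coeFn_toLp⟩
  rw [mul_assoc]
  refine Lp.norm_le_of_ae_bound (by positivity) ?_
  filter_upwards [hembed b, (hmem b).coeFn_toLp] with x h1 h2
  exact (congrArg norm h2).trans_le h1

theorem norm_pairing_le_norm_Lp_two [IsProbabilityMeasure μ] {b : B} {f : Lp ℂ 2 μ}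
    (hf : ⇑f =ᵐ[μ] ⇑(ι b)) {h : X → ℂ} (hh1 : ∀ x, ‖h x‖ ≤ 1) :
    ‖pairing ι h b‖ ≤ ‖f‖ := by
  have hfi : Integrable (f : X → ℂ) μ :=
    (integrable_congr hf).2 (L1.integrable_coeFn _)
  calc ‖pairing ι h b‖ ≤ ∫ x, ‖(f : X → ℂ) x‖ ∂μ := by
        refine norm_integral_le_of_norm_le hfi.norm ?_
        filter_upwards [hf] with x hx
        rw [hx, norm_mul]
        exact mul_le_of_le_one_right (norm_nonneg _) (hh1 x)
    _ = (eLpNorm (f : X → ℂ) 1 μ).toReal := by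
        rw [eLpNorm_one_eq_lintegral_enorm, integral_norm_eq_lintegral_enorm hfi.1]
    _ ≤ (eLpNorm (f : X → ℂ) 2 μ).toReal :=
        ENNReal.toReal_mono (Lp.eLpNorm_ne_top f)
          (eLpNorm_le_eLpNorm_of_exponent_le (by norm_num) hfi.1)
    _ = ‖f‖ := (Lp.norm_def f).symm

theorem IsReturnFamily.pairing_one_apply (hRn : IsReturnFamily φ F ι Rn κ) (n : ℕ) (b : B) :
    pairing ι (fun _ => 1) (Rn n b) = pairing ι ({x | φ x = n}.indicator fun _ => 1) b :=
  hRn.pairing_apply n b _ (.const 1)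

/-- On average, the renewal operators are close to the rank one operator
`b ↦ (∫ b / m) • 1`, uniformly over bounded sets. -/
theorem IsReturnFamily.exists_renewalSeq [CompleteSpace B] [IsProbabilityMeasure μ]
    (hRn : IsReturnFamily φ F ι Rn κ) (hκ : 0 ≤ κ) (hsum : Summable fun n => ‖Rn n‖)
    {one : B} (hone : ⇑(ι one) =ᵐ[μ] fun _ => (1 : ℂ)) {m : ℝ} (hm0 : 0 < m)
    (hm : HasSum (fun n : ℕ => n * μ.real {x | φ x = n}) m) {P : B →L[ℂ] B}
    (hP : ∀ b, P b = pairing ι (fun _ => 1) b • one) (hRP : (Rcal Rn 1).comp P = P)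
    (hPR : P.comp (Rcal Rn 1) = P) (hspec1 : IsUnit (1 - Rcal Rn 1 + P))
    (hspec2 : ∀ z : ℂ, ‖z‖ ≤ 1 → z ≠ 1 → IsUnit (1 - Rcal Rn z)) {r : ℝ} (hr : 0 ≤ r) :
    ∃ Tn : ℕ → B →L[ℂ] B, IsRenewalSeq Rn Tn ∧ ∃ N : B → ℝ,
      (∀ h : X → ℂ, (∀ x, ‖h x‖ ≤ 1) → ∀ b, ‖pairing ι h b‖ ≤ N b) ∧
      UnifCesaro fun (b : closedBall (0 : B) r) n =>
        N (Tn n b - (pairing ι (fun _ => 1) (b : B) / m) • one) := by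
  have hc1 : IsBddMeasurable fun _ : X => (1 : ℂ) := .const 1
  have heq : ∀ n, MeasurableSet {x | φ x = n} := fun n =>
    measurableSet_eq_fun hRn.measurable_time measurable_const
  obtain ⟨l, hl⟩ : ∃ l : B →L[ℂ] ℂ, ∀ b, l b = pairing ι (fun _ => 1) b :=
    ⟨((isLinearMap_pairing (ι := ι) hc1).mk' _).mkContinuous κ fun b => by
      simpa using norm_pairing_le hRn.bound hc1 b, fun b => rfl⟩
  have hl1 : l one = 1 := by
    rw [hl, pairing, integral_congr_ae (g := fun _ => 1)]
    · simp
    · filter_upwards [hone] with x hx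
      rw [hx, one_mul]
  have hone0 : one ≠ 0 := fun h => by simp [h] at hl1
  have hPl : P = l.smulRight one := by
    ext b
    rw [hP, ← hl]
    rfl
  have hPone : P one = one := by rw [hP, ← hl, hl1, one_smul]
  have h11 : Rcal Rn 1 one = one := by
    have := congrArg (fun f : B →L[ℂ] B => f one) hRP
    simpa [hPone] using this
  have hlR : ∀ b, l (Rcal Rn 1 b) = l b := by
    intro b
    have := congrArg (fun f : B →L[ℂ] B => f b) hPR
    simp only [ContinuousLinearMap.comp_apply, hP, ← hl] at this
    exact smul_left_injective ℂ hone0 this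
  have hind : ∀ n, ∫ x, ‖({x | φ x = n}.indicator (fun _ => (1 : ℂ))) x‖ ∂μ =
      μ.real {x | φ x = n} := by
    intro n
    simp only [norm_indicator_eq_indicator_norm, norm_one]
    rw [integral_indicator_const _ (heq n), smul_eq_mul, mul_one]
  have hlp : ∀ n b, ‖l (Rn n b)‖ ≤ κ * μ.real {x | φ x = n} * ‖b‖ := by
    intro n b
    rw [hl, hRn.pairing_one_apply]
    refine (norm_pairing_le hRn.bound (hc1.indicator (heq n)) b).trans_eq ?_
    rw [hind]
    ring
  have hp1 : ∀ n, l (Rn n one) = (μ.real {x | φ x = n} : ℝ) := by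
    intro n
    rw [hl, hRn.pairing_one_apply, pairing,
      integral_congr_ae (g := {x | φ x = n}.indicator fun _ => 1)]
    · rw [integral_indicator_const _ (heq n)]
      simp
    · filter_upwards [hone] with x hx
      rw [hx, one_mul]
  rw [hPl] at hspec1
  have hspec2' : ∀ z : ℂ, ‖z‖ < 1 → IsUnit (1 - Rcal Rn z) := fun z hz =>
    hspec2 z hz.le fun h => by simp [h] at hz
  obtain ⟨Tn, hTn, hTsum, hTs⟩ := exists_renewal_coeff hsum hspec2'
  obtain ⟨J, hJ⟩ := exists_continuousLinearMap_Lp_two hκ hRn.bound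
  refine ⟨Tn, hTn, fun b => ‖J b‖, fun h hh b => norm_pairing_le_norm_Lp_two (hJ b) hh, ?_⟩
  refine unifCesaro_norm_coeff
    (c := fun (b : closedBall (0 : B) r) n =>
      J (Tn n b - (pairing ι (fun _ => 1) (b : B) / m) • one))
    (G := fun b z => J (Ring.inverse (1 - Rcal Rn z) b - (l b / (m * (1 - z))) • one))
    (fun b z hz => ?_) (fun b s hs0 hs1 => ?_) fun ε hε => ?_
  · have h1 := (hTsum z hz).mapL (ContinuousLinearMap.apply ℂ B (b : B))
    have h2 : HasSum (fun n : ℕ => z ^ n • (l b / m) • one) ((l b / (m * (1 - z))) • one) := by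
      have := (hasSum_geometric_of_norm_lt_one hz).smul_const ((l b / m) • one)
      rwa [smul_smul, show (1 - z)⁻¹ * (l b / m) = l b / (m * (1 - z)) by
        rw [div_mul_eq_div_div]; ring] at this
    refine ((h1.sub h2).mapL J).congr_fun fun n => ?_
    rw [← map_smul, smul_sub, ← hl]
    rfl
  · have hs : Summable fun n : ℕ => s ^ n := summable_geometric_of_lt_one hs0 hs1
    refine Summable.of_nonneg_of_le (fun n => by positivity) (fun n => ?_)
      (((hTs s hs0 hs1).mul_left (‖J‖ * ‖(b : B)‖)).add
        (hs.mul_left (‖J‖ * ‖(l b / (m : ℂ)) • one‖)))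
    rw [← hl]
    calc s ^ n * ‖J (Tn n b - (l b / m) • one)‖
        ≤ s ^ n * (‖J‖ * (‖Tn n‖ * ‖(b : B)‖ + ‖(l b / (m : ℂ)) • one‖)) := by
          refine mul_le_mul_of_nonneg_left ?_ (by positivity)
          refine (J.le_opNorm _).trans (mul_le_mul_of_nonneg_left ?_ (norm_nonneg _))
          exact (norm_sub_le _ _).trans (add_le_add ((Tn n).le_opNorm _) le_rfl)
      _ = _ := by ring
  · obtain ⟨K, hK⟩ := norm_inverse_one_sub_Rcal_sub_le hsum l one h11 hl1 hlR hlp hp1 hm hm0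
      hspec1 hspec2 (ε := ε / (‖J‖ * r + 1)) (by positivity)
    refine ⟨‖J‖ * r * |K|, fun b z hz => ?_⟩
    have hb : ‖(b : B)‖ ≤ r := mem_closedBall_zero_iff.1 b.2
    calc _ ≤ ‖J‖ * ((ε / (‖J‖ * r + 1) / ‖1 - z‖ + K) * ‖(b : B)‖) :=
          (J.le_opNorm _).trans (mul_le_mul_of_nonneg_left (hK z hz b) (norm_nonneg _))
      _ ≤ ‖J‖ * ((ε / (‖J‖ * r + 1) / ‖1 - z‖ + |K|) * r) := by
          gcongr
          exact le_abs_self K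
      _ = ‖J‖ * r / (‖J‖ * r + 1) * (ε / ‖1 - z‖) + ‖J‖ * r * |K| := by ring
      _ ≤ _ := by
          gcongr
          refine mul_le_of_le_one_left (by positivity) ?_
          exact (div_le_one (by positivity)).2 (by linarith)

end RenewalTheorem

section UniformCesaro

variable {α β : Type*}

theorem UnifCesaro.mono {f g : α → ℕ → ℝ} (hg : UnifCesaro g) (h : ∀ a n, f a n ≤ g a n) :
    UnifCesaro f := fun ε hε => (hg ε hε).imp fun _ hL₀ L hL a =>
  (Finset.sum_le_sum fun n _ => h a n).trans (hL₀ L hL a)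

theorem UnifCesaro.of_shift {f : α → ℕ → ℝ} {g : β → ℕ → ℝ} (hg : UnifCesaro g)
    (σ : α → β) {k : ℕ} {C : ℝ} (hC : ∀ a, ∀ n < k, f a n ≤ C)
    (h : ∀ a n, f a (n + k) ≤ g (σ a) n) : UnifCesaro f := by
  intro ε hε
  obtain ⟨L₀, hL₀⟩ := hg (ε / 2) (by positivity)
  obtain ⟨L₁, hL₁⟩ := exists_nat_ge (k * |C| / (ε / 2))
  refine ⟨L₀ + L₁ + k, fun L hL a => ?_⟩
  obtain ⟨L', rfl⟩ := Nat.exists_eq_add_of_le (show k ≤ L by omega)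
  have h1 : ∑ n ∈ Finset.range k, f a n ≤ k * |C| := by
    calc _ ≤ ∑ n ∈ Finset.range k, |C| := Finset.sum_le_sum fun n hn =>
          (hC a n (Finset.mem_range.1 hn)).trans (le_abs_self C)
      _ = _ := by simp
  have h2 : ∑ n ∈ Finset.range L', f a (k + n) ≤ ε / 2 * L' :=
    (Finset.sum_le_sum fun n _ => by rw [add_comm k]; exact h a n).trans
      (hL₀ L' (by omega) (σ a))
  have h3 : k * |C| ≤ ε / 2 * L₁ := by
    rw [div_le_iff₀ (by positivity)] at hL₁
    linarith
  have h4 : (L₁ : ℝ) ≤ (k + L' : ℕ) := by exact_mod_cast (by omega : L₁ ≤ k + L')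
  have h5 : (L' : ℝ) ≤ (k + L' : ℕ) := by exact_mod_cast (by omega : L' ≤ k + L')
  rw [Finset.sum_range_add]
  have h6 := mul_le_mul_of_nonneg_left h4 (by positivity : 0 ≤ ε / 2)
  have h7 := mul_le_mul_of_nonneg_left h5 (by positivity : 0 ≤ ε / 2)
  linarith

theorem UnifCesaro.finset_sum {u : β → α → ℕ → ℝ} (s : Finset β)
    (hu : ∀ k ∈ s, UnifCesaro (u k)) : UnifCesaro fun a n => ∑ k ∈ s, u k a n := by
  classical
  induction s using Finset.induction_on with
  | empty => exact fun ε hε => ⟨0, fun L _ a => by simp; positivity⟩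
  | insert k s hk ih =>
    intro ε hε
    obtain ⟨L₀, hL₀⟩ := hu k (Finset.mem_insert_self k s) (ε / 2) (by positivity)
    obtain ⟨L₁, hL₁⟩ := ih (fun j hj => hu j (Finset.mem_insert_of_mem hj)) (ε / 2) (by positivity)
    refine ⟨L₀ + L₁, fun L hL a => ?_⟩
    simp only [Finset.sum_insert hk, Finset.sum_add_distrib]
    have h1 := hL₀ L (by omega) a
    have h2 := hL₁ L (by omega) a
    linarith

theorem UnifCesaro.tsum {u : ℕ → α → ℕ → ℝ} {t : ℕ → ℝ} (ht : Summable t)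
    (hu0 : ∀ k a n, 0 ≤ u k a n) (hut : ∀ k a n, u k a n ≤ t k) (hu : ∀ k, UnifCesaro (u k)) :
    UnifCesaro fun a n => ∑' k, u k a n := by
  intro ε hε
  obtain ⟨s, hs⟩ := ((tendsto_sum_nat_add t).eventually
    (gt_mem_nhds (show 0 < ε / 2 by positivity))).exists
  obtain ⟨L₀, hL₀⟩ := UnifCesaro.finset_sum (Finset.range s) (fun k _ => hu k) (ε / 2)
    (by positivity)
  refine ⟨L₀, fun L hL a => ?_⟩
  have hle : ∀ n, ∑' k, u k a n ≤ ∑ k ∈ Finset.range s, u k a n + ε / 2 := by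
    intro n
    have hsum : Summable fun k => u k a n :=
      Summable.of_nonneg_of_le (fun k => hu0 k a n) (fun k => hut k a n) ht
    rw [← hsum.sum_add_tsum_nat_add s]
    refine add_le_add le_rfl (le_trans ?_ hs.le)
    exact Summable.tsum_le_tsum (fun k => hut _ a n) ((summable_nat_add_iff s).2 hsum)
      ((summable_nat_add_iff s).2 ht)
  calc _ ≤ ∑ n ∈ Finset.range L, (∑ k ∈ Finset.range s, u k a n + ε / 2) :=
        Finset.sum_le_sum fun n _ => hle n
    _ ≤ ε / 2 * L + L * (ε / 2) := by
        rw [Finset.sum_add_distrib]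
        refine add_le_add (hL₀ L hL a) ?_
        simp
    _ = _ := by ring

end UniformCesaro

section InducedMeasure

variable {X : Type} [MeasurableSpace X] {μ : Measure X} {φ : X → ℕ} {F T : X → X}

theorem hasSum_mul_measureReal_eq [IsFiniteMeasure μ] (hφ : Measurable φ)
    (hφint : Integrable (fun x => (φ x : ℝ)) μ) :
    HasSum (fun n : ℕ => n * μ.real {x | φ x = n}) (∫ x, (φ x : ℝ) ∂μ) := by
  have heq : ∀ n, MeasurableSet {x | φ x = n} := fun n =>
    measurableSet_eq_fun hφ measurable_const
  have hU : ⋃ n, {x | φ x = n} = univ := by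
    ext x
    simp
  have := hasSum_integral_iUnion (f := fun x => (φ x : ℝ)) heq
    (fun i j hij => Set.disjoint_left.2 fun x hi hj => hij (Eq.trans (Eq.symm hi) hj))
    (μ := μ) (by rw [hU]; exact hφint.integrableOn)
  rw [hU, setIntegral_univ] at this
  refine this.congr_fun fun n => ?_
  rw [setIntegral_congr_fun (g := fun _ => (n : ℝ)) (heq n), setIntegral_const, smul_eq_mul,
    mul_comm]
  intro x hx
  exact congrArg _ hx

theorem tsum_measure_lt_eq (hφ : Measurable φ) (hφint : Integrable (fun x => (φ x : ℝ)) μ) :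
    ∑' k, μ {x | k < φ x} = ENNReal.ofReal (∫ x, (φ x : ℝ) ∂μ) := by
  have hgt : ∀ n, MeasurableSet {x | n < φ x} := fun n => measurableSet_lt measurable_const hφ
  rw [ofReal_integral_eq_lintegral_ofReal hφint (ae_of_all _ fun x => Nat.cast_nonneg _)]
  calc _ = ∑' k, ∫⁻ x, {x | k < φ x}.indicator (fun _ => 1) x ∂μ := by
        congr 1
        funext k
        rw [lintegral_indicator_const (hgt k), one_mul]
    _ = ∫⁻ x, ∑' k, {x | k < φ x}.indicator (fun _ => 1) x ∂μ :=
        (lintegral_tsum fun k => (measurable_const.indicator (hgt k)).aemeasurable).symm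
    _ = _ := by
        refine lintegral_congr fun x => ?_
        rw [tsum_eq_sum (s := Finset.range (φ x)), Finset.sum_congr rfl (g := fun _ => 1)]
        · simp
        · intro k hk
          exact indicator_of_mem (show x ∈ {x | k < φ x} from Finset.mem_range.1 hk) _
        · intro k hk
          exact indicator_of_notMem
            (show x ∉ {x | k < φ x} from fun h => hk (Finset.mem_range.2 h)) _

theorem isProbabilityMeasure_muX (hT : Measurable T) (hφ : Measurable φ)
    (hφint : Integrable (fun x => (φ x : ℝ)) μ) (h0 : 0 < ∫ x, (φ x : ℝ) ∂μ) :
    IsProbabilityMeasure (muX μ φ T) := by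
  refine ⟨?_⟩
  rw [muX, Measure.smul_apply, Measure.sum_apply _ MeasurableSet.univ, smul_eq_mul]
  have : ∀ k, (Measure.map T^[k] (μ.restrict {x | k < φ x})) univ = μ {x | k < φ x} := by
    intro k
    rw [Measure.map_apply (hT.iterate k) .univ, preimage_univ, Measure.restrict_apply_univ]
  simp only [this]
  rw [tsum_measure_lt_eq hφ hφint]
  exact ENNReal.inv_mul_cancel (by simpa using h0) ENNReal.ofReal_ne_top

theorem summable_tail (hφ : Measurable φ) (hφint : Integrable (fun x => (φ x : ℝ)) μ) :
    Summable (tail μ φ) := by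
  refine ENNReal.summable_toReal ?_
  rw [tsum_measure_lt_eq hφ hφint]
  exact ENNReal.ofReal_ne_top

theorem measurePreserving_muX (hT : Measurable T) (hφ : Measurable φ) (hφ1 : ∀ x, 1 ≤ φ x)
    (hF : ∀ x, F x = T^[φ x] x) (hFm : MeasurePreserving F μ μ) :
    MeasurePreserving T (muX μ φ T) (muX μ φ T) := by
  refine ⟨hT, Measure.ext fun A hA => ?_⟩
  rw [Measure.map_apply hT hA, muX, Measure.smul_apply, Measure.smul_apply,
    Measure.sum_apply _ hA, Measure.sum_apply _ (hT hA)]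
  congr 1
  have hgt : ∀ n, MeasurableSet {x | n < φ x} := fun n => measurableSet_lt measurable_const hφ
  have heq : ∀ n, MeasurableSet {x | φ x = n} := fun n =>
    measurableSet_eq_fun hφ measurable_const
  have h1 : ∀ k, (Measure.map T^[k] (μ.restrict {x | k < φ x})) (T ⁻¹' A) =
      μ (F ⁻¹' A ∩ {x | φ x = k + 1}) + μ (T^[k + 1] ⁻¹' A ∩ {x | k + 1 < φ x}) := by
    intro k
    rw [Measure.map_apply (hT.iterate k) (hT hA), Measure.restrict_apply (hT.iterate k (hT hA)),
      ← measure_union _ ((hT.iterate (k + 1) hA).inter (hgt (k + 1)))]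
    · congr 1
      ext x
      simp only [mem_inter_iff, mem_preimage, mem_union, mem_ofPred_eq, hF,
        ← Function.iterate_succ_apply']
      constructor
      · rintro ⟨hx, hk⟩
        rcases (Nat.succ_le_of_lt hk).eq_or_lt with h | h
        · left
          exact ⟨by rw [← h]; exact hx, h.symm⟩
        · exact Or.inr ⟨hx, h⟩
      · rintro (⟨hx, hk⟩ | ⟨hx, hk⟩)
        · rw [hk] at hx
          exact ⟨hx, by omega⟩
        · exact ⟨hx, by omega⟩
    · rw [Set.disjoint_left]
      rintro x ⟨-, h1⟩ ⟨-, h2⟩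
      simp only [mem_ofPred_eq] at h1 h2
      omega
  have h2 : ∀ k, (Measure.map T^[k] (μ.restrict {x | k < φ x})) A =
      μ (T^[k] ⁻¹' A ∩ {x | k < φ x}) := fun k => by
    rw [Measure.map_apply (hT.iterate k) hA, Measure.restrict_apply (hT.iterate k hA)]
  have h3 : ∑' k, μ (F ⁻¹' A ∩ {x | φ x = k + 1}) = μ A := by
    rw [← measure_iUnion, ← hFm.measure_preimage hA.nullMeasurableSet]
    · congr 1
      ext x
      simp only [mem_iUnion, mem_inter_iff, mem_ofPred_eq, exists_and_left, and_iff_left_iff_imp]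
      intro _
      exact ⟨φ x - 1, by have := hφ1 x; omega⟩
    · intro i j hij
      refine Set.disjoint_left.2 ?_
      rintro x ⟨-, h1⟩ ⟨-, h2⟩
      simp only [mem_ofPred_eq] at h1 h2
      omega
    · exact fun k => (hFm.measurable hA).inter (heq (k + 1))
  simp only [h1, h2]
  rw [ENNReal.tsum_add, h3]
  have h4 : T^[0] ⁻¹' A ∩ {x | 0 < φ x} = A := inter_eq_left.2 fun x _ => hφ1 x
  conv_rhs => rw [tsum_eq_zero_add' ENNReal.summable, h4]

theorem hasSum_integral_muX_of_sum_eq (h0 : 0 < ∫ x, (φ x : ℝ) ∂μ) {S : ℕ → X → X}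
    (hS : ∀ k, Measurable (S k))
    (hST : (Measure.sum fun k => Measure.map T^[k] (μ.restrict {x | k < φ x})) =
      Measure.sum fun k => Measure.map (S k) (μ.restrict {x | k < φ x}))
    {f : X → ℂ} (hf : Integrable f (muX μ φ T)) :
    HasSum (fun k : ℕ => ∫ x in {x | k < φ x}, f (S k x) ∂μ)
      ((∫ x, (φ x : ℝ) ∂μ) * ∫ x, f x ∂muX μ φ T) := by
  have hc0 : (ENNReal.ofReal (∫ x, (φ x : ℝ) ∂μ))⁻¹ ≠ 0 :=
    ENNReal.inv_ne_zero.2 ENNReal.ofReal_ne_top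
  have hc1 : (ENNReal.ofReal (∫ x, (φ x : ℝ) ∂μ))⁻¹ ≠ ⊤ :=
    ENNReal.inv_ne_top.2 (by simpa using h0)
  have hmu : muX μ φ T = (ENNReal.ofReal (∫ x, (φ x : ℝ) ∂μ))⁻¹ •
      Measure.sum fun k => Measure.map (S k) (μ.restrict {x | k < φ x}) := by
    rw [← hST]
    rfl
  rw [hmu] at hf ⊢
  have hint := (integrable_smul_measure hc0 hc1).1 hf
  rw [integral_smul_measure, ENNReal.toReal_inv, ENNReal.toReal_ofReal h0.le,
    Complex.real_smul, Complex.ofReal_inv, ← mul_assoc,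
    mul_inv_cancel₀ (by exact_mod_cast h0.ne'), one_mul]
  refine (hasSum_integral_measure hint).congr_fun fun k => ?_
  rw [integral_map (hS k).aemeasurable]
  exact (hint.mono_measure (Measure.le_sum _ k)).1

theorem hasSum_integral_muX (hT : Measurable T)
    (h0 : 0 < ∫ x, (φ x : ℝ) ∂μ) {f : X → ℂ} (hf : Integrable f (muX μ φ T)) :
    HasSum (fun k : ℕ => ∫ x in {x | k < φ x}, f (T^[k] x) ∂μ)
      ((∫ x, (φ x : ℝ) ∂μ) * ∫ x, f x ∂muX μ φ T) :=
  hasSum_integral_muX_of_sum_eq h0 hT.iterate rfl hf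

theorem measurable_iterate_sub (hT : Measurable T) (hφ : Measurable φ) (k : ℕ) :
    Measurable fun x => T^[φ x - (k + 1)] x := by
  have h : Measurable fun p : ℕ × X => T^[p.1] p.2 :=
    measurable_from_prod_countable_right fun n => hT.iterate n
  exact h.comp (((measurable_of_countable fun n : ℕ => n - (k + 1)).comp hφ).prodMk measurable_id)

theorem sum_map_iterate_eq_sum_map_iterate_sub (hT : Measurable T) (hφ : Measurable φ) :
    (Measure.sum fun k => Measure.map T^[k] (μ.restrict {x | k < φ x})) =
      Measure.sum fun k => Measure.map (fun x => T^[φ x - (k + 1)] x)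
        (μ.restrict {x | k < φ x}) := by
  have hgt : ∀ n, MeasurableSet {x | n < φ x} := fun n => measurableSet_lt measurable_const hφ
  refine Measure.ext fun A hA => ?_
  have key : ∀ S : ℕ → X → X, (∀ k, Measurable (S k)) →
      (Measure.sum fun k => Measure.map (S k) (μ.restrict {x | k < φ x})) A =
        ∫⁻ x, ∑ k ∈ Finset.range (φ x), A.indicator 1 (S k x) ∂μ := by
    intro S hS
    have hmeas : ∀ k, MeasurableSet (S k ⁻¹' A ∩ {x | k < φ x}) := fun k =>
      (hS k hA).inter (hgt k)
    rw [Measure.sum_apply _ hA]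
    calc _ = ∑' k, ∫⁻ x, (S k ⁻¹' A ∩ {x | k < φ x}).indicator (fun _ => 1) x ∂μ := by
          congr 1
          funext k
          rw [Measure.map_apply (hS k) hA, Measure.restrict_apply (hS k hA),
            lintegral_indicator_const (hmeas k), one_mul]
      _ = ∫⁻ x, ∑' k, (S k ⁻¹' A ∩ {x | k < φ x}).indicator (fun _ => 1) x ∂μ :=
          (lintegral_tsum fun k => (measurable_const.indicator (hmeas k)).aemeasurable).symm
      _ = _ := by
          refine lintegral_congr fun x => ?_
          rw [tsum_eq_sum (s := Finset.range (φ x))]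
          · refine Finset.sum_congr rfl fun k hk => ?_
            have hkx : k < φ x := Finset.mem_range.1 hk
            by_cases hx : S k x ∈ A
            · rw [indicator_of_mem (show x ∈ S k ⁻¹' A ∩ {x | k < φ x} from ⟨hx, hkx⟩),
                indicator_of_mem hx, Pi.one_apply]
            · have hx' : x ∉ S k ⁻¹' A ∩ {x | k < φ x} := fun h => hx h.1
              rw [indicator_of_notMem hx', indicator_of_notMem hx]
          · intro k hk
            have hx' : x ∉ S k ⁻¹' A ∩ {x | k < φ x} := fun h => hk (Finset.mem_range.2 h.2)
            exact indicator_of_notMem hx' _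
  rw [key _ hT.iterate, key _ (measurable_iterate_sub hT hφ)]
  refine lintegral_congr fun x => ?_
  rw [← Finset.sum_range_reflect]
  refine Finset.sum_congr rfl fun k _ => ?_
  rw [Nat.sub_sub, add_comm 1 k]

end InducedMeasure

section Mixing

variable {X : Type} [MeasurableSpace X]
variable {B : Type} [NormedAddCommGroup B] [NormedSpace ℂ B]
variable {μ : Measure X} {φ : X → ℕ} {F T : X → X} {ι : B →L[ℂ] Lp ℂ 1 μ} {Rn Tn : ℕ → B →L[ℂ] B}
  {κ : ℝ}

/-- Sequences of measurable functions bounded by one. -/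
def unitTestSeq (X : Type) [MeasurableSpace X] : Set (ℕ → X → ℂ) :=
  {W | ∀ m, Measurable (W m) ∧ ∀ x, ‖W m x‖ ≤ 1}

theorem IsReturnFamily.unifCesaro_pairing_iterate_sub [IsProbabilityMeasure μ]
    (hRn : IsReturnFamily φ F ι Rn κ) (hκ : 0 ≤ κ) (hTn : IsRenewalSeq Rn Tn) (hT : Measurable T)
    (hF : ∀ x, F x = T^[φ x] x) (hφint : Integrable (fun x => (φ x : ℝ)) μ)
    (h0 : 0 < ∫ x, (φ x : ℝ) ∂μ) {one : B} (hone : ⇑(ι one) =ᵐ[μ] fun _ => (1 : ℂ)) {N : B → ℝ}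
    (hN : ∀ h : X → ℂ, (∀ x, ‖h x‖ ≤ 1) → ∀ b, ‖pairing ι h b‖ ≤ N b) {r : ℝ} (hr : 0 ≤ r)
    (hNT : UnifCesaro fun (b : closedBall (0 : B) r) n =>
      N (Tn n b - (pairing ι (fun _ => 1) (b : B) / (∫ x, (φ x : ℝ) ∂μ : ℝ)) • one)) :
    UnifCesaro fun (a : closedBall (0 : B) r × unitTestSeq X) m =>
      ‖pairing ι (fun x => (a.2 : ℕ → X → ℂ) m (T^[m] x)) a.1 -
        pairing ι (fun _ => 1) (a.1 : B) * ∫ x, (a.2 : ℕ → X → ℂ) m x ∂muX μ φ T‖ := by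
  have hprob := isProbabilityMeasure_muX hT hRn.measurable_time hφint h0
  have hgt : ∀ n, MeasurableSet {x | n < φ x} := fun n =>
    measurableSet_lt measurable_const hRn.measurable_time
  set φb := ∫ x, (φ x : ℝ) ∂μ with hφb
  let h : ℕ → closedBall (0 : B) r × unitTestSeq X → ℕ → X → ℂ := fun k a m =>
    {x | k < φ x}.indicator fun x => (a.2 : ℕ → X → ℂ) m (T^[k] x)
  have hW : ∀ (a : closedBall (0 : B) r × unitTestSeq X) m,
      IsBddMeasurable ((a.2 : ℕ → X → ℂ) m) := fun a m => ⟨(a.2.2 m).1, 1, (a.2.2 m).2⟩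
  have hh : ∀ k a m, IsBddMeasurable (h k a m) := fun k a m =>
    ((hW a m).comp (hT.iterate k)).indicator (hgt k)
  have hh1 : ∀ k a m x, ‖h k a m x‖ ≤ {x | k < φ x}.indicator (fun _ => (1 : ℝ)) x := by
    intro k a m x
    rw [norm_indicator_eq_indicator_norm]
    exact indicator_le_indicator ((a.2.2 m).2 _)
  have hhint : ∀ k a m, ∫ x, ‖h k a m x‖ ∂μ ≤ tail μ φ k := by
    intro k a m
    refine (integral_mono ((hh k a m).integrable μ).norm
      ((integrable_const (1 : ℝ)).indicator (hgt k)) (hh1 k a m)).trans_eq ?_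
    rw [integral_indicator_const _ (hgt k), smul_eq_mul, mul_one]
    rfl
  have hpone : ∀ k a m, pairing ι (h k a m) one = ∫ x, h k a m x ∂μ := by
    intro k a m
    refine integral_congr_ae ?_
    filter_upwards [hone] with x hx
    rw [hx, one_mul]
  let d : closedBall (0 : B) r → ℂ := fun b => pairing ι (fun _ => 1) (b : B) / (φb : ℂ)
  have hd : ∀ b, ‖d b‖ ≤ κ * r / φb := by
    intro b
    simp only [d]
    rw [norm_div, Complex.norm_real, Real.norm_of_nonneg h0.le]
    gcongr
    refine (norm_pairing_le hRn.bound (.const 1) (b : B)).trans ?_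
    simpa using mul_le_mul_of_nonneg_left (mem_closedBall_zero_iff.1 b.2) hκ
  let v : ℕ → closedBall (0 : B) r × unitTestSeq X → ℕ → ℂ := fun k a m =>
    if k ≤ m then pairing ι (h k a m) (Tn (m - k) a.1 - d a.1 • one)
    else -(d a.1 * ∫ x, h k a m x ∂μ)
  have hvsub : ∀ k a m, v k a m = (if k ≤ m then pairing ι (h k a m) (Tn (m - k) a.1) else 0) -
      d a.1 * ∫ x, h k a m x ∂μ := by
    intro k a m
    simp only [v]
    split_ifs
    · have hlin := isLinearMap_pairing (ι := ι) (hh k a m)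
      rw [hlin.map_sub, hlin.map_smul, hpone, smul_eq_mul]
    · rw [zero_sub]
  have hvsum : ∀ a m, HasSum (fun k => v k a m)
      (pairing ι (fun x => (a.2 : ℕ → X → ℂ) m (T^[m] x)) a.1 -
        pairing ι (fun _ => 1) (a.1 : B) * ∫ x, (a.2 : ℕ → X → ℂ) m x ∂muX μ φ T) := by
    intro a m
    have h1 : HasSum (fun k => if k ≤ m then pairing ι (h k a m) (Tn (m - k) a.1) else 0)
        (pairing ι (fun x => (a.2 : ℕ → X → ℂ) m (T^[m] x)) a.1) := by
      rw [hRn.pairing_iterate hTn hT hF (hW a m), ← Finset.Nat.sum_antidiagonal_swap]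
      simp only [Prod.fst_swap, Prod.snd_swap]
      rw [Finset.Nat.sum_antidiagonal_eq_sum_range_succ
        (fun k i => pairing ι (h k a m) (Tn i a.1))]
      have := hasSum_sum_of_ne_finset_zero (s := Finset.range m.succ)
        (f := fun k => if k ≤ m then pairing ι (h k a m) (Tn (m - k) a.1) else 0) (by
          intro k hk
          rw [if_neg]
          simpa using hk) (L := .unconditional ℕ)
      rwa [Finset.sum_congr rfl] at this
      intro k hk
      rw [if_pos]
      exact Nat.lt_succ_iff.1 (Finset.mem_range.1 hk)
    have h2 := (hasSum_integral_muX hT h0 ((hW a m).integrable (muX μ φ T))).mul_left (d a.1)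
    have h3 : d a.1 * (φb * ∫ x, (a.2 : ℕ → X → ℂ) m x ∂muX μ φ T) =
        pairing ι (fun _ => 1) (a.1 : B) * ∫ x, (a.2 : ℕ → X → ℂ) m x ∂muX μ φ T := by
      have : (φb : ℂ) ≠ 0 := by exact_mod_cast h0.ne'
      simp only [d]
      field_simp
    rw [h3] at h2
    refine (h1.sub h2).congr_fun fun k => ?_
    rw [hvsub, integral_indicator (hgt k)]
  have ht0 : 0 ≤ κ * r + κ * r / φb := by positivity
  have hvt : ∀ k a m, ‖v k a m‖ ≤ (κ * r + κ * r / φb) * tail μ φ k := by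
    intro k a m
    rw [hvsub, add_mul]
    refine (norm_sub_le _ _).trans (add_le_add ?_ ?_)
    · have : 0 ≤ κ * r * tail μ φ k :=
        mul_nonneg (by positivity) ENNReal.toReal_nonneg
      split_ifs
      · refine (hRn.norm_pairing_renewal_le hκ hTn (hh k a m) _ _).trans ?_
        have := mem_closedBall_zero_iff.1 a.1.2
        gcongr
        exact hhint k a m
      · simpa using this
    · rw [norm_mul]
      exact mul_le_mul (hd a.1) ((norm_integral_le_integral_norm _).trans (hhint k a m))
        (norm_nonneg _) (by positivity)
  have hts : Summable fun k => (κ * r + κ * r / φb) * tail μ φ k :=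
    (summable_tail hRn.measurable_time hφint).mul_left _
  refine (UnifCesaro.tsum (u := fun k a m => ‖v k a m‖) hts (fun k a m => norm_nonneg _) hvt
    fun k => ?_).mono fun a m => ?_
  · refine hNT.of_shift Prod.fst (k := k) (fun a n _ => hvt k a n) fun a n => ?_
    have h1 : v k a (n + k) = pairing ι (h k a (n + k)) (Tn n a.1 - d a.1 • one) := by
      simp only [v]
      rw [if_pos (Nat.le_add_left k n), Nat.add_sub_cancel]
    rw [h1]
    refine hN _ (fun x => (hh1 k a _ x).trans ?_) _
    exact indicator_le_self' (fun _ _ => zero_le_one) x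
  · rw [← (hvsum a m).tsum_eq]
    exact norm_tsum_le_tsum_norm
      (Summable.of_nonneg_of_le (fun _ => norm_nonneg _) (fun k => hvt k a m) hts)

end Mixing

section Correlations

variable {X : Type} [MeasurableSpace X]
variable {B : Type} [NormedAddCommGroup B] [NormedSpace ℂ B]
variable {μ : Measure X} {φ : X → ℕ} {F T : X → X} {ι : B →L[ℂ] Lp ℂ 1 μ} {Rn Tn : ℕ → B →L[ℂ] B}
  {κ : ℝ}

/-- The transfer operator of `F` restricted to `{φ > k}`. -/
def tailOp (Rn : ℕ → B →L[ℂ] B) (k : ℕ) : B →L[ℂ] B :=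
  ∑' m, Rn (m + (k + 1))

theorem norm_tailOp_le (hsum : Summable fun n => ‖Rn n‖) (k : ℕ) :
    ‖tailOp Rn k‖ ≤ ∑' n, ‖Rn n‖ := by
  have h := (summable_nat_add_iff (k + 1)).2 hsum
  refine (norm_tsum_le_tsum_norm h).trans ?_
  rw [← hsum.sum_add_tsum_nat_add (k + 1)]
  exact le_add_of_nonneg_left (Finset.sum_nonneg fun _ _ => norm_nonneg _)

theorem IsReturnFamily.pairing_tailOp [CompleteSpace B] [IsFiniteMeasure μ]
    (hRn : IsReturnFamily φ F ι Rn κ) (hsum : Summable fun n => ‖Rn n‖) {h : X → ℂ}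
    (hh : IsBddMeasurable h) (k : ℕ) (b : B) :
    pairing ι h (tailOp Rn k b) = pairing ι ({x | k < φ x}.indicator fun x => h (F x)) b := by
  have hgt : ∀ n, MeasurableSet {x | n < φ x} := fun n =>
    measurableSet_lt measurable_const hRn.measurable_time
  have heq : ∀ n, MeasurableSet {x | φ x = n} := fun n =>
    measurableSet_eq_fun hRn.measurable_time measurable_const
  have hF := hRn.measurePreserving.measurable
  let l : B →L[ℂ] ℂ := ((isLinearMap_pairing (ι := ι) hh).mk' _).mkContinuous
    (κ * ∫ x, ‖h x‖ ∂μ) fun b => (norm_pairing_le hRn.bound hh b).trans_eq (by ring)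
  have h1 : HasSum (fun m => Rn (m + (k + 1)) b) (tailOp Rn k b) :=
    ((summable_nat_add_iff (k + 1)).2 hsum).of_norm.hasSum.mapL
      (ContinuousLinearMap.apply ℂ B b)
  have h2 := h1.mapL l
  have h3 := hasSum_integral_iUnion (f := fun x => (ι b : X → ℂ) x * h (F x))
    (s := fun m => {x | φ x = m + (k + 1)}) (fun m => heq _)
    (fun i j hij => Set.disjoint_left.2 fun x hi hj =>
      hij (Nat.add_right_cancel (Eq.trans (Eq.symm hi) hj)))
    (μ := μ) ((hh.comp hF).integrable_mul (L1.integrable_coeFn _)).integrableOn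
  have hU : ⋃ m, {x | φ x = m + (k + 1)} = {x | k < φ x} := by
    ext x
    simp only [mem_iUnion, mem_ofPred_eq]
    exact ⟨fun ⟨m, hm⟩ => by omega, fun hx => ⟨φ x - (k + 1), by omega⟩⟩
  have hind : ∀ s : Set X, MeasurableSet s →
      pairing ι (s.indicator fun x => h (F x)) b = ∫ x in s, (ι b : X → ℂ) x * h (F x) ∂μ := by
    intro s hs
    rw [← integral_indicator hs, pairing]
    congr 1
    funext x
    rw [indicator_mul_right]
  rw [hU] at h3
  rw [hind _ (hgt k)]
  refine h2.unique (h3.congr_fun fun m => ?_)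
  rw [← hind _ (heq _)]
  exact hRn.pairing_apply _ _ _ hh

/-- Measurable exchangeable observables bounded by one, of exchangeability norm at most one. -/
def unitObservables (μ : Measure X) (Y : Set X) (T : X → X) (φ : X → ℕ) (ι : B →L[ℂ] Lp ℂ 1 μ) :
    Set (X → ℝ) :=
  {v | Measurable v ∧ (∀ x, |v x| ≤ 1) ∧ ExchBound μ Y T φ ι v 1}

/-- Sequences of measurable real functions bounded by one. -/
def unitRealTestSeq (X : Type) [MeasurableSpace X] : Set (ℕ → X → ℝ) :=
  {W | ∀ m, Measurable (W m) ∧ ∀ x, |W m x| ≤ 1}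

theorem isBddMeasurable_ofReal {f : X → ℝ} (hf : Measurable f) (hf1 : ∀ x, |f x| ≤ 1) :
    IsBddMeasurable fun x => (f x : ℂ) :=
  ⟨Complex.measurable_ofReal.comp hf, 1, fun x => by simpa using hf1 x⟩

theorem IsReturnFamily.exists_setIntegral_eq_pairing [CompleteSpace B] [IsFiniteMeasure μ]
    (hRn : IsReturnFamily φ F ι Rn κ) (hsum : Summable fun n => ‖Rn n‖)
    (hF : ∀ x, F x = T^[φ x] x) {Y : Set X} {v : X → ℝ} (hv : ExchBound μ Y T φ ι v 1) (k : ℕ) :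
    ∃ β : closedBall (0 : B) (∑' n, ‖Rn n‖), ∀ (w : X → ℂ) (m : ℕ), IsBddMeasurable w →
      Measurable T →
      ∫ x in {x | k < φ x}, v (T^[φ x - (k + 1)] x) *
        w (T^[m + (k + 1)] (T^[φ x - (k + 1)] x)) ∂μ = pairing ι (fun x => w (T^[m] x)) β := by
  have hgt : MeasurableSet {x | k < φ x} := measurableSet_lt measurable_const hRn.measurable_time
  obtain ⟨b, hb1, hb⟩ := hv (fun x => v (T^[φ x - (k + 1)] x)) fun n hn =>
    ⟨n - (k + 1), by omega, fun y _ hy => by subst hy; rfl⟩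
  refine ⟨⟨tailOp Rn k b, mem_closedBall_zero_iff.2 ?_⟩, fun w m hw hT => ?_⟩
  · exact ((tailOp Rn k).le_of_opNorm_le (norm_tailOp_le hsum k) b).trans
      (mul_le_of_le_one_right (tsum_nonneg fun _ => norm_nonneg _) hb1)
  · rw [hRn.pairing_tailOp hsum (hw.comp (hT.iterate m)), pairing, ← integral_indicator hgt]
    refine integral_congr_ae ?_
    filter_upwards [hb] with x hx
    rw [← indicator_mul_right]
    by_cases hxk : x ∈ {x | k < φ x}
    · have hxk' : k < φ x := hxk
      rw [indicator_of_mem hxk, indicator_of_mem hxk, hx, hF, ← Function.iterate_add_apply,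
        ← Function.iterate_add_apply,
        show m + (k + 1) + (φ x - (k + 1)) = m + φ x by omega]
    · rw [indicator_of_notMem hxk, indicator_of_notMem hxk]

theorem IsReturnFamily.unifCesaro_abs_rho [CompleteSpace B] [IsProbabilityMeasure μ]
    (hRn : IsReturnFamily φ F ι Rn κ) (hsum : Summable fun n => ‖Rn n‖) (hT : Measurable T)
    (hF : ∀ x, F x = T^[φ x] x) (hφint : Integrable (fun x => (φ x : ℝ)) μ)
    (h1 : 1 ≤ ∫ x, (φ x : ℝ) ∂μ) (Y : Set X)
    (hmix : UnifCesaro fun (a : closedBall (0 : B) (∑' n, ‖Rn n‖) × unitTestSeq X) m =>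
      ‖pairing ι (fun x => (a.2 : ℕ → X → ℂ) m (T^[m] x)) a.1 -
        pairing ι (fun _ => 1) (a.1 : B) * ∫ x, (a.2 : ℕ → X → ℂ) m x ∂muX μ φ T‖) :
    UnifCesaro fun (a : unitObservables μ Y T φ ι × unitRealTestSeq X) n =>
      |rho (muX μ φ T) T a.1 ((a.2 : ℕ → X → ℝ) n) n| := by
  have h0 : 0 < ∫ x, (φ x : ℝ) ∂μ := zero_lt_one.trans_le h1
  have hφ := hRn.measurable_time
  have hprob := isProbabilityMeasure_muX hT hφ hφint h0
  have hgt : ∀ n, MeasurableSet {x | n < φ x} := fun n => measurableSet_lt measurable_const hφ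
  set φb := ∫ x, (φ x : ℝ) ∂μ with hφb
  let S : ℕ → X → X := fun k x => T^[φ x - (k + 1)] x
  have hS : ∀ k, Measurable (S k) := measurable_iterate_sub hT hφ
  let ν : ℕ → (X → ℂ) → ℂ := fun k f => ∫ x in {x | k < φ x}, f (S k x) ∂μ
  have hν : ∀ f : X → ℂ, IsBddMeasurable f →
      HasSum (fun k => ν k f) (φb * ∫ x, f x ∂muX μ φ T) := fun f hf =>
    hasSum_integral_muX_of_sum_eq h0 hS (sum_map_iterate_eq_sum_map_iterate_sub hT hφ)
      (hf.integrable _)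
  have hνle : ∀ k (f : X → ℂ), (∀ x, ‖f x‖ ≤ 1) → ‖ν k f‖ ≤ tail μ φ k := by
    intro k f hf
    refine (norm_setIntegral_le_of_norm_le_const (C := 1) (measure_lt_top _ _)
      fun x _ => hf _).trans_eq ?_
    rw [one_mul]
    rfl
  let w : unitObservables μ Y T φ ι × unitRealTestSeq X → ℕ → X → ℂ := fun a n x =>
    ((a.2 : ℕ → X → ℝ) n x : ℂ)
  have hw : ∀ a n, IsBddMeasurable (w a n) := fun a n =>
    isBddMeasurable_ofReal (a.2.2 n).1 (a.2.2 n).2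
  have hw1 : ∀ a n x, ‖w a n x‖ ≤ 1 := fun a n x => by simpa [w] using (a.2.2 n).2 x
  let v : unitObservables μ Y T φ ι × unitRealTestSeq X → X → ℂ := fun a x =>
    ((a.1 : X → ℝ) x : ℂ)
  have hv : ∀ a, IsBddMeasurable (v a) := fun a => isBddMeasurable_ofReal a.1.2.1 a.1.2.2.1
  have hv1 : ∀ a x, ‖v a x‖ ≤ 1 := fun a x => by simpa [v] using a.1.2.2.1 x
  let u : ℕ → unitObservables μ Y T φ ι × unitRealTestSeq X → ℕ → ℂ := fun k a n =>
    ν k (fun x => v a x * w a n (T^[n] x)) - ν k (v a) * ∫ x, w a n x ∂muX μ φ T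
  have hu : ∀ a n, HasSum (fun k => u k a n)
      (φb * (rho (muX μ φ T) T a.1 ((a.2 : ℕ → X → ℝ) n) n : ℝ)) := by
    intro a n
    have h2 := (hν _ ((hv a).mul ((hw a n).comp (hT.iterate n)))).sub
      ((hν _ (hv a)).mul_right (∫ x, w a n x ∂muX μ φ T))
    have h3 : (rho (muX μ φ T) T a.1 ((a.2 : ℕ → X → ℝ) n) n : ℂ) =
        ∫ x, v a x * w a n (T^[n] x) ∂muX μ φ T -
          (∫ x, v a x ∂muX μ φ T) * ∫ x, w a n x ∂muX μ φ T := by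
      simp only [rho, v, w, Complex.ofReal_sub, Complex.ofReal_mul, ← integral_complex_ofReal]
    rw [h3, mul_sub, ← mul_assoc]
    exact h2
  have hut : ∀ k a n, ‖u k a n‖ ≤ 2 * tail μ φ k := by
    intro k a n
    have h2 : ‖∫ x, w a n x ∂muX μ φ T‖ ≤ 1 := by
      simpa using norm_integral_le_of_norm_le_const (μ := muX μ φ T) (ae_of_all _ (hw1 a n))
    refine (norm_sub_le _ _).trans ?_
    rw [two_mul, norm_mul]
    refine add_le_add (hνle k (fun x => v a x * w a n (T^[n] x)) fun x => ?_)
      ((mul_le_of_le_one_right (norm_nonneg _) h2).trans (hνle k _ (hv1 a)))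
    rw [norm_mul]
    exact mul_le_one₀ (hv1 a x) (norm_nonneg _) (hw1 a n _)
  have hts : Summable fun k => 2 * tail μ φ k := (summable_tail hφ hφint).mul_left _
  refine (UnifCesaro.tsum (u := fun k a n => ‖u k a n‖) hts (fun k a n => norm_nonneg _) hut
    fun k => ?_).mono fun a n => ?_
  · choose β hβ using fun a : unitObservables μ Y T φ ι × unitRealTestSeq X =>
      hRn.exists_setIntegral_eq_pairing hsum hF a.1.2.2.2 k
    refine hmix.of_shift (fun a => (β a, ⟨fun m => w a (m + (k + 1)), fun m =>
      ⟨(hw a _).1, hw1 a _⟩⟩)) (k := k + 1) (fun a n _ => hut k a n) fun a n => ?_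
    have e1 := hβ a (w a (n + (k + 1))) n (hw a _) hT
    have e2 := hβ a (fun _ => 1) n (.const 1) hT
    simp only [mul_one] at e2
    rw [← e1, ← e2]
  · have h2 : |rho (muX μ φ T) T a.1 ((a.2 : ℕ → X → ℝ) n) n| ≤ ‖(φb : ℂ) *
        (rho (muX μ φ T) T a.1 ((a.2 : ℕ → X → ℝ) n) n : ℝ)‖ := by
      rw [norm_mul, Complex.norm_real, Complex.norm_real, Real.norm_of_nonneg h0.le]
      exact le_mul_of_one_le_left (abs_nonneg _) h1
    refine h2.trans ?_
    rw [← (hu a n).tsum_eq]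
    exact norm_tsum_le_tsum_norm
      (Summable.of_nonneg_of_le (fun _ => norm_nonneg _) (fun k => hut k a n) hts)

end Correlations

section UniformRate

theorem exists_tendsto_zero_of_uniform {α : Type*} {f : α → ℕ → ℝ} {C : ℝ} (hf0 : ∀ a n, 0 ≤ f a n)
    (hfC : ∀ a n, f a n ≤ C) (hf : ∀ ε > 0, ∃ L₀ : ℕ, ∀ n ≥ L₀, ∀ a, f a n ≤ ε) :
    ∃ s : ℕ → ℝ, (∀ n, 0 < s n) ∧ Tendsto s atTop (𝓝 0) ∧ ∀ a n, f a n ≤ s n := by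
  have hbdd : ∀ n, BddAbove (range fun a => f a n) := fun n =>
    ⟨C, by rintro _ ⟨a, rfl⟩; exact hfC a n⟩
  have h0 : ∀ n, 0 ≤ ⨆ a, f a n := fun n => Real.iSup_nonneg fun a => hf0 a n
  have hpos : ∀ n : ℕ, 0 < 1 / ((n : ℝ) + 1) := fun n => by positivity
  refine ⟨fun n => 1 / ((n : ℝ) + 1) + ⨆ a, f a n,
    fun n => add_pos_of_pos_of_nonneg (hpos n) (h0 n), ?_, fun a n => (le_ciSup (hbdd n) a).trans (le_add_of_nonneg_left (hpos n).le)⟩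
  have hlim : Tendsto (fun n => ⨆ a, f a n) atTop (𝓝 0) := by
    rw [Metric.tendsto_atTop]
    intro ε hε
    obtain ⟨L₀, hL₀⟩ := hf (ε / 2) (by positivity)
    refine ⟨L₀, fun n hn => ?_⟩
    rw [Real.dist_eq, sub_zero, abs_of_nonneg (h0 n)]
    exact (Real.iSup_le (hL₀ n hn) (by positivity)).trans_lt (half_lt_self hε)
  simpa using tendsto_one_div_add_atTop_nhds_zero_nat.add hlim

variable {X : Type} [MeasurableSpace X]

theorem rho_comp_iterate {ν : Measure X} {T : X → X} (hT : MeasurePreserving T ν ν) {v w : X → ℝ}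
    (hw : Measurable w) {j n : ℕ} (hj : j ≤ n) :
    rho ν T v (fun x => w (T^[n - j] x)) j = rho ν T v w n := by
  have h := hT.iterate (n - j)
  have h1 : ∫ x, w (T^[n - j] x) ∂ν = ∫ x, w x ∂ν := by
    conv_rhs => rw [← h.map_eq]
    exact (integral_map h.measurable.aemeasurable hw.aestronglyMeasurable).symm
  simp only [rho, h1, ← Function.iterate_add_apply, Nat.sub_add_cancel hj]

theorem rho_congr_ae {ν : Measure X} {T : X → X} (hT : MeasurePreserving T ν ν) {v v' w w' : X → ℝ}
    (hv : v =ᵐ[ν] v') (hw : w =ᵐ[ν] w') (n : ℕ) : rho ν T v w n = rho ν T v' w' n := by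
  rw [rho, rho, integral_congr_ae hv, integral_congr_ae hw]
  congr 1
  refine integral_congr_ae ?_
  filter_upwards [hv, (hT.iterate n).quasiMeasurePreserving.ae_eq_comp hw] with x h1 h2
  have h2' : w (T^[n] x) = w' (T^[n] x) := h2
  rw [h1, h2']

theorem rho_const_mul {ν : Measure X} {T : X → X} (c d : ℝ) (v w : X → ℝ) (n : ℕ) :
    rho ν T (fun x => c * v x) (fun x => d * w x) n = c * d * rho ν T v w n := by
  simp only [rho, integral_const_mul, mul_mul_mul_comm c _ d]
  ring

theorem exists_measurable_abs_le_ae_eq {ν : Measure X} {f : X → ℝ} {C : ℝ}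
    (hf : AEStronglyMeasurable f ν) (hC0 : 0 ≤ C) (hC : ∀ᵐ x ∂ν, |f x| ≤ C) :
    ∃ g : X → ℝ, Measurable g ∧ (∀ x, |g x| ≤ C) ∧ f =ᵐ[ν] g := by
  refine ⟨fun x => max (-C) (min C (hf.mk f x)), ?_, fun x => ?_, ?_⟩
  · exact measurable_const.max (measurable_const.min hf.stronglyMeasurable_mk.measurable)
  · exact abs_le.2 ⟨le_max_left _ _, max_le (by linarith) (min_le_left _ _)⟩
  · filter_upwards [hf.ae_eq_mk, hC] with x h1 h2
    rw [← h1, min_eq_right (abs_le.1 h2).2, max_eq_right (abs_le.1 h2).1]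

theorem nonneg_of_ae_abs_le {ν : Measure X} [IsProbabilityMeasure ν] {f : X → ℝ} {C : ℝ}
    (hC : ∀ᵐ x ∂ν, |f x| ≤ C) : 0 ≤ C :=
  hC.exists.elim fun _ hx => (abs_nonneg _).trans hx

variable {B : Type} [NormedAddCommGroup B] [NormedSpace ℂ B]
variable {μ : Measure X} {φ : X → ℕ} {F T : X → X} {Y : Set X} {ι : B →L[ℂ] Lp ℂ 1 μ}
  {v v' : X → ℝ} {M : ℝ}

theorem ExchBound.nonneg (hv : ExchBound μ Y T φ ι v M) : 0 ≤ M := by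
  obtain ⟨b, hb, -⟩ := hv v fun n hn => ⟨0, hn, fun _ _ _ => rfl⟩
  exact (norm_nonneg b).trans hb

theorem ExchBound.const_mul (hv : ExchBound μ Y T φ ι v M) {c : ℝ} (hc : 0 < c) :
    ExchBound μ Y T φ ι (fun x => c * v x) (c * M) := by
  intro vhat hvhat
  obtain ⟨b, hb, hbv⟩ := hv (fun x => c⁻¹ * vhat x) fun n hn =>
    (hvhat n hn).imp fun j hj => ⟨hj.1, fun y hy hyn => by
      simp only [hj.2 y hy hyn]
      rw [inv_mul_cancel_left₀ hc.ne']⟩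
  refine ⟨(c : ℂ) • b, ?_, ?_⟩
  · rw [norm_smul, Complex.norm_real, Real.norm_of_nonneg hc.le]
    exact mul_le_mul_of_nonneg_left hb hc.le
  · rw [map_smul]
    filter_upwards [Lp.coeFn_smul (c : ℂ) (ι b), hbv] with x h1 h2
    rw [h1, Pi.smul_apply, h2, smul_eq_mul, ← Complex.ofReal_mul, mul_inv_cancel_left₀ hc.ne']

theorem ExchBound.mono {M' : ℝ} (hv : ExchBound μ Y T φ ι v M) (h : M ≤ M') :
    ExchBound μ Y T φ ι v M' := fun vhat hvhat =>
  (hv vhat hvhat).imp fun _ hb => ⟨hb.1.trans h, hb.2⟩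

theorem ae_forall_lt_of_ae_muX (hT : Measurable T) (hφ : Measurable φ) {p : X → Prop}
    (hp : ∀ᵐ x ∂muX μ φ T, p x) : ∀ᵐ y ∂μ, ∀ ℓ < φ y, p (T^[ℓ] y) := by
  rw [muX, Measure.ae_ennreal_smul_measure_iff (ENNReal.inv_ne_zero.2 ENNReal.ofReal_ne_top),
    Measure.ae_sum_iff] at hp
  refine ae_all_iff.2 fun ℓ => ?_
  exact (ae_restrict_iff' (measurableSet_lt measurable_const hφ)).1
    (ae_of_ae_map (hT.iterate ℓ).aemeasurable (hp ℓ))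

theorem ExchBound.congr_ae (hv : ExchBound μ Y T φ ι v M) (hT : Measurable T) (hφ : Measurable φ)
    (hφ1 : ∀ x, 1 ≤ φ x) (hY : μ Yᶜ = 0) (h : v =ᵐ[muX μ φ T] v') :
    ExchBound μ Y T φ ι v' M := by
  intro vhat hvhat
  choose j hj hjv using hvhat
  obtain ⟨b, hb, hbv⟩ := hv (fun y => v (T^[j (φ y) (hφ1 y)] y)) fun n hn =>
    ⟨j n hn, hj n hn, fun y _ hy => by subst hy; rfl⟩
  refine ⟨b, hb, ?_⟩
  filter_upwards [hbv, ae_forall_lt_of_ae_muX hT hφ h, mem_ae_iff.2 hY] with y h1 h2 hyY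
  rw [h1, h2 _ (hj _ (hφ1 y)), hjv _ (hφ1 y) y hyY rfl]

theorem exists_rate_of_unifCesaro_abs_rho [IsProbabilityMeasure (muX μ φ T)]
    (hT : MeasurePreserving T (muX μ φ T) (muX μ φ T)) (hφ : Measurable φ)
    (hφ1 : ∀ x, 1 ≤ φ x) (hY : μ Yᶜ = 0)
    (hrho : UnifCesaro fun (a : unitObservables μ Y T φ ι × unitRealTestSeq X) n =>
      |rho (muX μ φ T) T a.1 ((a.2 : ℕ → X → ℝ) n) n|) :
    ∃ a : ℕ → ℝ, (∀ n, 0 < a n) ∧ Tendsto a atTop (𝓝 0) ∧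
      ∀ (v : X → ℝ) (M Minf : ℝ), ExchBound μ Y T φ ι v M →
        AEStronglyMeasurable v (muX μ φ T) → (∀ᵐ x ∂muX μ φ T, |v x| ≤ Minf) →
        ∃ Cv : ℝ, 0 < Cv ∧
          ∀ (w : X → ℝ) (Mw : ℝ), AEStronglyMeasurable w (muX μ φ T) →
            (∀ᵐ x ∂muX μ φ T, |w x| ≤ Mw) →
            ∀ n, |rho (muX μ φ T) T v w n| ≤ Cv * Mw * a n := by
  set ν := muX μ φ T with hν
  let U : Set (X → ℝ) := {w | Measurable w ∧ ∀ x, |w x| ≤ 1}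
  have hbound : ∀ f : X → ℝ, (∀ x, |f x| ≤ 1) → |∫ x, f x ∂ν| ≤ 1 := fun f hf => by
    simpa using norm_integral_le_of_norm_le_const (μ := ν) (f := f) (C := 1) (ae_of_all _ hf)
  suffices h : (∀ (a : unitObservables μ Y T φ ι × U) n, |rho ν T a.1 a.2 n| ≤ 2) ∧
      ∀ ε > 0, ∃ L₀ : ℕ, ∀ n ≥ L₀, ∀ a : unitObservables μ Y T φ ι × U,
        |rho ν T a.1 a.2 n| ≤ ε by
    obtain ⟨s, hs0, hs, hrs⟩ := exists_tendsto_zero_of_uniform (fun a n => abs_nonneg _) h.1 h.2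
    refine ⟨s, hs0, hs, fun v M Minf hv hvm hvb => ?_⟩
    have hM := hv.nonneg
    have hMinf := nonneg_of_ae_abs_le hvb
    have hC : 0 < M + Minf + 1 := by positivity
    refine ⟨M + Minf + 1, hC, fun w Mw hwm hwb n => ?_⟩
    have hMw := nonneg_of_ae_abs_le hwb
    obtain ⟨v', hv'm, hv'b, hvv'⟩ := exists_measurable_abs_le_ae_eq hvm hMinf hvb
    obtain ⟨w', hw'm, hw'b, hww'⟩ := exists_measurable_abs_le_ae_eq hwm hMw hwb
    have hv' := ((hv.congr_ae hT.measurable hφ hφ1 hY hvv').const_mul (inv_pos.2 hC)).mono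
      (M' := 1) (by rw [inv_mul_le_iff₀ hC]; linarith)
    have h := hrs (⟨_, hv'm.const_mul (M + Minf + 1)⁻¹, fun x => ?_, hv'⟩,
      ⟨_, hw'm.const_mul Mw⁻¹, fun x => ?_⟩) n
    · have hw'' : w' = fun x => Mw * (Mw⁻¹ * w' x) := by
        funext x
        rcases hMw.eq_or_lt with h0 | h0
        · rw [← h0, zero_mul]
          exact abs_nonpos_iff.1 (h0 ▸ hw'b x)
        · rw [mul_inv_cancel_left₀ h0.ne']
      have hv'' : v' = fun x => (M + Minf + 1) * ((M + Minf + 1)⁻¹ * v' x) := by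
        funext x
        rw [mul_inv_cancel_left₀ hC.ne']
      rw [rho_congr_ae hT hvv' hww', hw'', hv'', rho_const_mul, abs_mul,
        abs_of_nonneg (by positivity : 0 ≤ (M + Minf + 1) * Mw)]
      exact mul_le_mul_of_nonneg_left h (by positivity)
    · rw [abs_mul, abs_of_pos (inv_pos.2 hC), inv_mul_le_iff₀ hC]
      linarith [hv'b x]
    · rw [abs_mul, abs_of_nonneg (inv_nonneg.2 hMw)]
      exact inv_mul_le_one_of_le₀ (hw'b x) hMw
  refine ⟨fun a n => ?_, fun ε hε => ?_⟩
  · have h1 := hbound (fun x => (a.1 : X → ℝ) x * (a.2 : X → ℝ) (T^[n] x)) fun x => by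
      rw [abs_mul]
      exact mul_le_one₀ (a.1.2.2.1 x) (abs_nonneg _) (a.2.2.2 _)
    have h2 := mul_le_one₀ (hbound _ a.1.2.2.1) (abs_nonneg _) (hbound _ a.2.2.2)
    rw [← abs_mul] at h2
    exact (abs_sub _ _).trans (by linarith)
  · obtain ⟨L₀, hL₀⟩ := hrho ε hε
    refine ⟨L₀, fun n hn a => ?_⟩
    have h := hL₀ (n + 1) (by omega) (a.1, ⟨fun j x => (a.2 : X → ℝ) (T^[n - j] x), fun j =>
      ⟨a.2.2.1.comp (hT.measurable.iterate _), fun x => a.2.2.2 _⟩⟩)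
    rw [Finset.sum_congr rfl (g := fun _ => |rho ν T a.1 a.2 n|), Finset.sum_const,
      Finset.card_range, nsmul_eq_mul, mul_comm] at h
    · exact le_of_mul_le_mul_right h (by positivity)
    · intro j hj
      exact congrArg _ (rho_comp_iterate hT a.2.2.1 (Nat.lt_succ_iff.1 (Finset.mem_range.1 hj)))

end UniformRate

section Transfer

variable {X : Type} [MeasurableSpace X] {B : Type} [NormedAddCommGroup B] [NormedSpace ℂ B]
variable {μ : Measure X} {φ : X → ℕ} {F : X → X} {ι : B →L[ℂ] Lp ℂ 1 μ} {Rn : ℕ → B →L[ℂ] B}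
  {κ : ℝ}

theorem IsReturnFamily.of_transfer (hφ : Measurable φ) (hφ1 : ∀ x, 1 ≤ φ x)
    (hF : MeasurePreserving F μ μ) (hRn0 : Rn 0 = 0) {R : Lp ℂ 1 μ →L[ℂ] Lp ℂ 1 μ}
    (hR : ∀ (v : Lp ℂ 1 μ) (w : X → ℂ), Measurable w → (∃ c, ∀ x, ‖w x‖ ≤ c) →
      ∫ x, (R v : X → ℂ) x * w x ∂μ = ∫ x, (v : X → ℂ) x * w (F x) ∂μ)
    (hRnR : ∀ n : ℕ, 1 ≤ n → ∀ b : B, ∀ g : Lp ℂ 1 μ,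
      ⇑g =ᵐ[μ] {x | φ x = n}.indicator ⇑(ι b) → ⇑(ι (Rn n b)) =ᵐ[μ] ⇑(R g))
    (hbound : ∀ b : B, ∀ᵐ x ∂μ, ‖(ι b : X → ℂ) x‖ ≤ κ * ‖b‖) :
    IsReturnFamily φ F ι Rn κ where
  measurable_time := hφ
  one_le_time := hφ1
  measurePreserving := hF
  zero := hRn0
  bound := hbound
  pairing_apply := by
    intro p b h hh
    rcases p.eq_zero_or_pos with rfl | hp
    · have hempty : {x | φ x = 0} = ∅ := eq_empty_of_forall_notMem fun x hx =>
        absurd (hφ1 x) (by rw [show φ x = 0 from hx]; decide)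
      rw [hRn0, hempty, indicator_empty, zero_apply, (isLinearMap_pairing hh).map_zero]
      simp [pairing]
    · have hint : Integrable ({x | φ x = p}.indicator ⇑(ι b)) μ :=
        (L1.integrable_coeFn (ι b)).indicator (measurableSet_eq_fun hφ measurable_const)
      have hg := hint.coeFn_toL1
      calc pairing ι h (Rn p b) = ∫ x, (R (hint.toL1 _) : X → ℂ) x * h x ∂μ := by
            refine integral_congr_ae ?_
            filter_upwards [hRnR p hp b _ hg] with x hx
            rw [hx]
        _ = ∫ x, (hint.toL1 _ : X → ℂ) x * h (F x) ∂μ := hR _ h hh.1 hh.2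
        _ = _ := by
            refine integral_congr_ae ?_
            filter_upwards [hg] with x hx
            rw [hx, ← indicator_mul_right _ ⇑(ι b) fun x => h (F x),
              indicator_mul_left _ ⇑(ι b) fun x => h (F x)]

end Transfer

/-- Theorem 1.6.  Suppose the inducing scheme is excellent ((H1) and (H2)),
`B(Y)` is embedded in `L^∞(Y)`, and `B(X)` is a collection of exchangeable observables.
If `μ(φ > n) = O(1/(n log n))` (and `φ ∈ L¹`), then correlations decay at a uniform rate:
there is a sequence `a_n > 0`, `a_n → 0`, such that every bounded exchangeable `v` has a
constant `C_v > 0` with `|ρ_{v,w}(n)| ≤ C_v |w|_∞ a_n` for all `w ∈ L^∞(X)` and `n ≥ 1`. -/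
theorem stmt_2
    {X : Type} [MeasurableSpace X] (μ : Measure X) [IsProbabilityMeasure μ]
    (Y : Set X) (hYmeas : MeasurableSet Y) (hYfull : μ Yᶜ = 0)
    (T : X → X) (hT : Measurable T)
    (φ : X → ℕ) (hφmeas : Measurable φ) (hφ1 : ∀ x, 1 ≤ φ x)
    (hφint : Integrable (fun x => (φ x : ℝ)) μ)
    (F : X → X) (hF : ∀ x, F x = T^[φ x] x) (hFY : ∀ y ∈ Y, F y ∈ Y)
    (hFerg : Ergodic F μ)
    {B : Type} [NormedAddCommGroup B] [NormedSpace ℂ B] [CompleteSpace B]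
    -- `B(Y) ⊆ L¹(Y)`, with `‖v‖₁ ≤ ‖v‖` and `1 ∈ B(Y)`
    (ι : B →L[ℂ] Lp ℂ 1 μ) (hι : ∀ b : B, ‖ι b‖ ≤ ‖b‖)
    (hιinj : Function.Injective fun b : B => ι b)
    (one : B) (hone : ⇑(ι one) =ᵐ[μ] fun _ => (1 : ℂ))
    -- the transfer operator `R` of `F`
    (R : Lp ℂ 1 μ →L[ℂ] Lp ℂ 1 μ)
    (hR : ∀ (v : Lp ℂ 1 μ) (w : X → ℂ), Measurable w → (∃ c, ∀ x, ‖w x‖ ≤ c) →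
      ∫ x, (R v : X → ℂ) x * w x ∂μ = ∫ x, (v : X → ℂ) x * w (F x) ∂μ)
    -- `Rₙ v = R (1_{φ = n} v)`, bounded on `B(Y)`
    (Rn : ℕ → B →L[ℂ] B) (hRn0 : Rn 0 = 0)
    (hRnR : ∀ n : ℕ, 1 ≤ n → ∀ b : B, ∀ g : Lp ℂ 1 μ,
      ⇑g =ᵐ[μ] {x | φ x = n}.indicator ⇑(ι b) →
      ⇑(ι (Rn n b)) =ᵐ[μ] ⇑(R g))
    -- hypothesis (H2)
    (P : B →L[ℂ] B)
    (hP : ∀ b : B, P b = (∫ x, (ι b : X → ℂ) x ∂μ) • one)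
    (hRP : (Rcal Rn 1).comp P = P) (hPR : P.comp (Rcal Rn 1) = P)
    (hspec1 : IsUnit (1 - Rcal Rn 1 + P))
    (hspec2 : ∀ z : ℂ, ‖z‖ ≤ 1 → z ≠ 1 → IsUnit (1 - Rcal Rn z))

    -- hypothesis (H1)
    (C₁ : ℝ) (hC₁ : 0 < C₁) (hH1 : ∀ n : ℕ, 1 ≤ n → ‖Rn n‖ ≤ C₁ * tail μ φ n)
    -- `B(Y)` embedded in `L^∞(Y)`
    (cBound : ℝ) (hcBound : 0 < cBound)
    (hembed : ∀ b : B, ∀ᵐ x ∂μ, ‖(ι b : X → ℂ) x‖ ≤ cBound * ‖b‖)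
    -- `μ(φ > n) = O(1/(n log n))`
    (C₂ : ℝ) (hC₂ : 0 < C₂)
    (htail : ∀ n : ℕ, 2 ≤ n → tail μ φ n ≤ C₂ / ((n : ℝ) * Real.log n)) :
    ∃ a : ℕ → ℝ, (∀ n, 0 < a n) ∧ Tendsto a atTop (nhds 0) ∧
      ∀ (v : X → ℝ) (M Minf : ℝ), ExchBound μ Y T φ ι v M →
        Integrable v (muX μ φ T) → (∀ᵐ x ∂muX μ φ T, |v x| ≤ Minf) →
        ∃ Cv : ℝ, 0 < Cv ∧
          ∀ (w : X → ℝ) (Mw : ℝ), AEStronglyMeasurable w (muX μ φ T) →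
            (∀ᵐ x ∂muX μ φ T, |w x| ≤ Mw) →
            ∀ n : ℕ, 1 ≤ n → |rho (muX μ φ T) T v w n| ≤ Cv * Mw * a n := by
  have hRn : IsReturnFamily φ F ι Rn cBound :=
    .of_transfer hφmeas hφ1 hFerg.toMeasurePreserving hRn0 hR hRnR hembed
  have h1 : 1 ≤ ∫ x, (φ x : ℝ) ∂μ := by
    simpa using integral_mono (integrable_const (1 : ℝ)) hφint fun x => Nat.one_le_cast.2 (hφ1 x)
  have h0 : 0 < ∫ x, (φ x : ℝ) ∂μ := zero_lt_one.trans_le h1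
  have hsum : Summable fun n => ‖Rn n‖ :=
    Summable.of_nonneg_of_le (fun n => norm_nonneg _) (fun n => by
      rcases n.eq_zero_or_pos with rfl | hn
      · rw [hRn0, norm_zero]
        exact mul_nonneg hC₁.le ENNReal.toReal_nonneg
      · exact hH1 n hn) ((summable_tail hφmeas hφint).mul_left C₁)
  have hr : 0 ≤ ∑' n, ‖Rn n‖ := tsum_nonneg fun _ => norm_nonneg _
  obtain ⟨Tn, hTn, N, hN, hNT⟩ := hRn.exists_renewalSeq hcBound.le hsum hone h0
    (hasSum_mul_measureReal_eq hφmeas hφint) (fun b => by simp only [hP, pairing, mul_one]) hRP hPR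
    hspec1 hspec2 hr
  have hmix := hRn.unifCesaro_pairing_iterate_sub hcBound.le hTn hT hF hφint h0 hone hN hr hNT
  have := isProbabilityMeasure_muX hT hφmeas hφint h0
  obtain ⟨a, ha0, ha, hrate⟩ := exists_rate_of_unifCesaro_abs_rho
    (measurePreserving_muX hT hφmeas hφ1 hF hFerg.toMeasurePreserving) hφmeas hφ1 hYfull
    (hRn.unifCesaro_abs_rho hsum hT hF hφint h1 Y hmix)
  refine ⟨a, ha0, ha, fun v M Minf hv hvint hvb => ?_⟩
  obtain ⟨Cv, hCv, h⟩ := hrate v M Minf hv hvint.aestronglyMeasurable hvb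
  exact ⟨Cv, hCv, fun w Mw hw hwb n _ => h w Mw hw hwb n⟩
end
end

section
/- Assume hypotheses (*) and (H2), and suppose a = a(k) ∈ (0,∞) satisfies lim_{k→∞} a(k) S_0(k,a(k)) = 0. Then there exist δ > 0, k₀ ≥ 1 and C > 0 such that for every k ≥ k₀ there are continuous families z ↦ λ′(z) ∈ ℂ and z ↦ P′(z) of bounded rank-one projections on B(Y), defined for z ∈ D_{a(k)} ∩ B_δ(1), with the following properties: R′(z)P′(z) = P′(z)R′(z) = λ′(z)P′(z); λ′(1) = 1 and P′(1) = P; |λ′(z)| ≤ C and ‖P′(z)‖ ≤ C; and, writing Q′(z) = I − P′(z), the restriction of I − R′(z) to the range of Q′(z) is boundedly invertible, i.e. there is a bounded operator G(z) on B(Y) with G(z)Q′(z) = Q′(z)G(z) = G(z), G(z)(I − R′(z)) = (I − R′(z))G(z) = Q′(z), and ‖G(z)‖ ≤ C. -/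
noncomputable section

open MeasureTheory Filter Set Metric
open scoped Topology ENNReal NNReal

variable {B : Type} [NormedAddCommGroup B] [NormedSpace ℂ B] [CompleteSpace B]

/-- tail sum `U_j = ∑_{ℓ>j} R_ℓ`. -/
def Utail (Rn : ℕ → B →L[ℂ] B) (j : ℕ) : B →L[ℂ] B :=
  ∑' ℓ : ℕ, Rn (j + 1 + ℓ)

/-- the truncated operators `R'_n` corresponding to `φ' = min (φ, k)`:
`R'_n = R_n` for `n < k`, `R'_k = ∑_{j≥k} R_j`, and `R'_n = 0` for `n > k`. -/
def Rntr (Rn : ℕ → B →L[ℂ] B) (k n : ℕ) : B →L[ℂ] B :=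
  if n < k then Rn n else if n = k then ∑' ℓ : ℕ, Rn (k + ℓ) else 0

/-- the truncated series `R'(z) = ∑_{n=1}^{k} zⁿ R'_n`. -/
def Rcaltr (Rn : ℕ → B →L[ℂ] B) (k : ℕ) (z : ℂ) : B →L[ℂ] B :=
  ∑ n ∈ Finset.range (k + 1), z ^ n • Rntr Rn k n

/-- `R'_1(z) = (z-1)⁻¹ (R'(z) - R'(1)) = ∑_{j=0}^{k-1} U_j z^j`. -/
def R1tr (Rn : ℕ → B →L[ℂ] B) (k : ℕ) (z : ℂ) : B →L[ℂ] B :=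
  ∑ j ∈ Finset.range k, z ^ j • Utail Rn j

/-- `R̃'(z) = R'_1(z) - R'_1(1)`. -/
def Rttr (Rn : ℕ → B →L[ℂ] B) (k : ℕ) (z : ℂ) : B →L[ℂ] B :=
  R1tr Rn k z - R1tr Rn k 1

section Algebra

variable {A : Type*} [Ring A] [Algebra ℂ A]

/-- If `J` inverts `x - T + P` and `P J P = P`, then `c⁻¹ J P J` is an idempotent commuting with
`T` on whose range `T` acts as multiplication by `x`. -/
theorem eigenprojection_of_inverse {T P J : A} {x c : ℂ}
    (hl : J * (x • 1 - T + P) = 1) (hr : (x • 1 - T + P) * J = 1) (hPJ : P * J * P = P)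
    (hc : c ≠ 0) (hPJJ : P * J * J * P = c • P) :
    T * (c⁻¹ • (J * P * J)) = x • (c⁻¹ • (J * P * J)) ∧
    (c⁻¹ • (J * P * J)) * T = x • (c⁻¹ • (J * P * J)) ∧
    (c⁻¹ • (J * P * J)) * (c⁻¹ • (J * P * J)) = c⁻¹ • (J * P * J) := by
  have hTJ : T * J = x • J + P * J - 1 := by
    rw [← hr]; simp only [add_mul, sub_mul, smul_mul_assoc, one_mul]; abel
  have hJT : J * T = x • J + J * P - 1 := by
    rw [← hl]; simp only [mul_add, mul_sub, mul_smul_comm, mul_one]; abel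
  refine ⟨?_, ?_, ?_⟩
  · rw [mul_smul_comm, smul_comm x]
    congr 1
    rw [← mul_assoc, ← mul_assoc, hTJ]
    simp only [add_mul, sub_mul, smul_mul_assoc, one_mul, hPJ]
    abel
  · rw [smul_mul_assoc, smul_comm x]
    congr 1
    rw [mul_assoc, hJT]
    simp only [mul_add, mul_sub, mul_smul_comm, mul_one]
    rw [← mul_assoc (J * P) J P, mul_assoc J P J, mul_assoc J (P * J) P, hPJ]
    abel
  · have : J * P * J * (J * P * J) = c • (J * P * J) := by
      calc J * P * J * (J * P * J) = J * (P * J * J * P) * J := by simp only [mul_assoc]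
        _ = _ := by rw [hPJJ, mul_smul_comm, smul_mul_assoc]
    rw [smul_mul_smul_comm, this, smul_smul, mul_assoc, inv_mul_cancel₀ hc, mul_one]

/-- An inverse of `1 - T + Q` restricts to an inverse of `1 - T` on the range of `1 - Q`. -/
theorem reduced_resolvent_of_inverse {T Q K : A} {x : ℂ}
    (hTQ : T * Q = x • Q) (hQT : Q * T = x • Q) (hQQ : Q * Q = Q)
    (hl : K * (1 - T + Q) = 1) (hr : (1 - T + Q) * K = 1) :
    (K * (1 - Q)) * (1 - Q) = K * (1 - Q) ∧ (1 - Q) * (K * (1 - Q)) = K * (1 - Q) ∧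
    (K * (1 - Q)) * (1 - T) = 1 - Q ∧ (1 - T) * (K * (1 - Q)) = 1 - Q := by
  have hcomm : Q * (1 - T + Q) = (1 - T + Q) * Q := by
    simp only [mul_add, mul_sub, add_mul, sub_mul, hTQ, hQT, mul_one, one_mul]
  have hQK : Q * K = K * Q := by
    calc Q * K = K * (1 - T + Q) * Q * K := by rw [hl, one_mul]
      _ = K * (Q * (1 - T + Q)) * K := by rw [hcomm, mul_assoc K]
      _ = K * Q := by rw [mul_assoc, mul_assoc Q, hr, mul_one]
  have hidem : (1 - Q) * (1 - Q) = 1 - Q := by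
    simp only [mul_sub, sub_mul, mul_one, one_mul, hQQ]; abel
  have hQ'K : (1 - Q) * K = K * (1 - Q) := by
    rw [sub_mul, mul_sub, hQK, one_mul, mul_one]
  have hl' : (1 - Q) * (1 - T) = (1 - T + Q) * (1 - Q) := by
    simp only [mul_sub, add_mul, sub_mul, hTQ, hQT, hQQ, mul_one, one_mul]; abel
  have hr' : (1 - T) * (1 - Q) = (1 - T + Q) * (1 - Q) := by
    simp only [mul_sub, add_mul, sub_mul, hTQ, hQQ, mul_one, one_mul]; abel
  refine ⟨?_, ?_, ?_, ?_⟩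
  · rw [mul_assoc, hidem]
  · rw [← mul_assoc, hQ'K, mul_assoc, hidem]
  · rw [mul_assoc, hl', ← mul_assoc, hl, one_mul]
  · rw [← hQ'K, ← mul_assoc, hr', mul_assoc, hQ'K, ← mul_assoc, hr, one_mul]

end Algebra

/-- Perturbation of a simple isolated eigenvalue `1` with spectral projection `P = ψ ⊗ e`. -/
theorem exists_eigenprojection_near {R P : B →L[ℂ] B} {ψ : B →L[ℂ] ℂ} {e : B} (he : ψ e = 1)
    (hP : ∀ b, P b = ψ b • e) (hRP : R * P = P) (hPR : P * R = P) (hU : IsUnit (1 - R + P)) :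
    ∃ (lam : (B →L[ℂ] B) → ℂ) (Q : (B →L[ℂ] B) → B →L[ℂ] B), lam R = 1 ∧ Q R = P ∧
      ∃ C : ℝ, 0 < C ∧ ∀ᶠ T in 𝓝 R, ContinuousAt lam T ∧ ContinuousAt Q T ∧
        T * Q T = lam T • Q T ∧ Q T * T = lam T • Q T ∧ Q T * Q T = Q T ∧
        (∃ (χ : B →L[ℂ] ℂ) (b : B), ∀ x : B, Q T x = χ x • b) ∧
        ‖lam T‖ ≤ C ∧ ‖Q T‖ ≤ C ∧
        ∃ G : B →L[ℂ] B, G * (1 - Q T) = G ∧ (1 - Q T) * G = G ∧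
          G * (1 - T) = 1 - Q T ∧ (1 - T) * G = 1 - Q T ∧ ‖G‖ ≤ C := by
  have hPe : P e = e := by rw [hP, he, one_smul]
  have hRe : R e = e := by
    have := congrArg (fun S : B →L[ℂ] B => S e) hRP
    simpa [hPe] using this
  have hPSP (S : B →L[ℂ] B) : P * S * P = ψ (S e) • P := by
    ext b
    simp [hP, smul_smul, mul_comm]
  let f : (B →L[ℂ] B) × ℂ → ℂ := fun u => ψ (Ring.inverse (u.2 • 1 - u.1 + P) e)
  have hU1 : IsUnit ((1 : ℂ) • (1 : B →L[ℂ] B) - R + P) := by rwa [one_smul]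
  have hinv : ContDiffAt ℂ 1 (fun u : (B →L[ℂ] B) × ℂ => Ring.inverse (u.2 • 1 - u.1 + P))
      (R, 1) := by
    obtain ⟨w, hw⟩ := hU1
    refine ContDiffAt.comp (R, (1 : ℂ)) (g := Ring.inverse)
      (f := fun u : (B →L[ℂ] B) × ℂ => u.2 • (1 : B →L[ℂ] B) - u.1 + P) ?_ (by fun_prop)
    simpa only [hw] using contDiffAt_ringInverse ℂ w
  have hf : ContDiffAt ℂ 1 f (R, 1) :=
    ψ.contDiff.contDiffAt.comp _ (hinv.clm_apply contDiffAt_const)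
  have hunit : ∀ᶠ u : (B →L[ℂ] B) × ℂ in 𝓝 (R, 1), IsUnit (u.2 • 1 - u.1 + P) := by
    have hc : ContinuousAt (fun u : (B →L[ℂ] B) × ℂ => u.2 • (1 : B →L[ℂ] B) - u.1 + P)
      (R, 1) := by fun_prop
    exact hc.eventually (Units.isOpen.mem_nhds hU1)
  have hinve {x : ℂ} (hx : x ≠ 0) (hu : IsUnit (x • 1 - R + P)) :
      Ring.inverse (x • 1 - R + P) e = x⁻¹ • e := by
    have h1 : (x • 1 - R + P) e = x • e := by simp [hRe, hPe]
    have h2 : Ring.inverse (x • 1 - R + P) ((x • 1 - R + P) e) = e := by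
      rw [← mul_apply_eq_comp, Ring.inverse_mul_cancel _ hu]; rfl
    rw [h1, map_smul] at h2
    rw [← h2, smul_smul, inv_mul_cancel₀ hx, one_smul, h2]
  have hf1 : f (R, 1) = 1 := by
    simp only [f]
    rw [hinve one_ne_zero hU1, inv_one, one_smul, he]
  have hder : fderiv ℂ f (R, 1) ∘L .inr ℂ (B →L[ℂ] B) ℂ = -ContinuousLinearMap.id ℂ ℂ := by
    have h1 : HasFDerivAt (fun x : ℂ => f (R, x))
        (fderiv ℂ f (R, 1) ∘L .inr ℂ (B →L[ℂ] B) ℂ) 1 :=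
      (hf.differentiableAt one_ne_zero).hasFDerivAt.comp (1 : ℂ) (hasFDerivAt_prodMk_right R 1)
    have hev : (fun x : ℂ => f (R, x)) =ᶠ[𝓝 1] fun x => x⁻¹ := by
      have hc : ContinuousAt (fun x : ℂ => ((R, x) : (B →L[ℂ] B) × ℂ)) 1 := by fun_prop
      filter_upwards [hc.eventually hunit, isOpen_ne.mem_nhds (one_ne_zero (α := ℂ))]
        with x hx hx0
      simp only [f]
      rw [hinve hx0 hx, map_smul, he, smul_eq_mul, mul_one]
    have h2 := ((hasDerivAt_inv (one_ne_zero (α := ℂ))).congr_of_eventuallyEq hev).hasFDerivAt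
    rw [h1.unique h2]
    ext
    simp
  have hif : (fderiv ℂ f (R, 1) ∘L .inr ℂ (B →L[ℂ] B) ℂ).IsInvertible := by
    rw [hder]
    exact ⟨ContinuousLinearEquiv.neg ℂ, by ext; simp⟩
  let lam := hf.implicitFunction one_ne_zero hif
  have hlam1 : lam R = 1 := hf.implicitFunction_apply_self one_ne_zero hif
  have hlamC : ContDiffAt ℂ 1 lam R := hf.contDiffAt_implicitFunction one_ne_zero hif
  have hpair : ContDiffAt ℂ 1 (fun T => (T, lam T)) R := contDiffAt_id.prodMk hlamC
  have hlamf : ∀ᶠ T in 𝓝 R, f (T, lam T) = 1 := by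
    have := hf.eventually_apply_implicitFunction one_ne_zero hif
    rwa [hf1] at this
  let J : (B →L[ℂ] B) → B →L[ℂ] B := fun T => Ring.inverse (lam T • 1 - T + P)
  have hJC : ContDiffAt ℂ 1 J R := by
    refine ContDiffAt.comp (f := fun T => (T, lam T))
      (g := fun u : (B →L[ℂ] B) × ℂ => Ring.inverse (u.2 • 1 - u.1 + P)) R ?_ hpair
    rwa [hlam1]
  let c : (B →L[ℂ] B) → ℂ := fun T => ψ ((J T * J T) e)
  have hcC : ContDiffAt ℂ 1 c R :=
    ψ.contDiff.contDiffAt.comp _ ((hJC.mul hJC).clm_apply contDiffAt_const)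
  have hJR : J R = Ring.inverse (1 - R + P) := by simp only [J, hlam1, one_smul]
  have hJe : J R e = e := by
    have := hinve one_ne_zero hU1
    rwa [one_smul, inv_one, one_smul, ← hJR] at this
  have hcR : c R = 1 := by
    simp only [c, mul_apply_eq_comp, hJe, he]
  let Q : (B →L[ℂ] B) → B →L[ℂ] B := fun T => (c T)⁻¹ • (J T * P * J T)
  have hQC : ContDiffAt ℂ 1 Q R := by
    refine ContDiffAt.smul (hcC.inv ?_) ((hJC.mul contDiffAt_const).mul hJC)
    rw [hcR]; exact one_ne_zero
  have hPJ : P * J R = P := by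
    have : P * (1 - R + P) = P := by
      have hPP := hPSP 1
      rw [mul_one, one_apply_eq_self, he, one_smul] at hPP
      rw [mul_add, mul_sub, mul_one, hPR, hPP]; abel
    calc P * J R = P * (1 - R + P) * J R := by rw [this]
      _ = P := by rw [hJR, mul_assoc, Ring.mul_inverse_cancel _ hU, mul_one]
  have hJP : J R * P = P := by
    ext b
    simp [hP, hJe]
  have hQR : Q R = P := by
    simp only [Q, hcR, inv_one, one_smul]
    rw [hJP, hPJ]
  let K : (B →L[ℂ] B) → B →L[ℂ] B := fun T => Ring.inverse (1 - T + Q T)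
  have hNc : ContinuousAt (fun T => 1 - T + Q T) R := by
    have := hQC.continuousAt
    fun_prop
  have hU' : IsUnit (1 - R + Q R) := by rwa [hQR]
  have hKc : ContinuousAt K R := by
    obtain ⟨w, hw⟩ := hU'
    refine ContinuousAt.comp (g := Ring.inverse) (f := fun T => 1 - T + Q T) ?_ hNc
    rw [← hw]
    exact NormedRing.inverse_continuousAt w
  have hGc : ContinuousAt (fun T => K T * (1 - Q T)) R :=
    hKc.mul (continuousAt_const.sub hQC.continuousAt)
  have hbound {E : Type} [NormedAddCommGroup E] {g : (B →L[ℂ] B) → E} (hg : ContinuousAt g R) :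
      ∀ᶠ T in 𝓝 R, ‖g T‖ < ‖g R‖ + 1 :=
    hg.norm.eventually (gt_mem_nhds (lt_add_one _))
  refine ⟨lam, Q, hlam1, hQR, (‖lam R‖ + 1) + (‖Q R‖ + 1) + (‖K R * (1 - Q R)‖ + 1),
    by positivity, ?_⟩
  have hlamc : ∀ᶠ T in 𝓝 R, ContDiffAt ℂ 1 lam T := hlamC.eventually (by simp)
  have hQc : ∀ᶠ T in 𝓝 R, ContDiffAt ℂ 1 Q T := hQC.eventually (by simp)
  have hpu : ∀ᶠ T in 𝓝 R, IsUnit (lam T • 1 - T + P) := by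
    have h := hpair.continuousAt
    rw [ContinuousAt, hlam1] at h
    exact h.eventually hunit
  have hc0 : ∀ᶠ T in 𝓝 R, c T ≠ 0 :=
    hcC.continuousAt.eventually_ne (by rw [hcR]; exact one_ne_zero)
  filter_upwards [hlamc, hQc, hpu, hc0, hlamf, hNc.eventually (Units.isOpen.mem_nhds hU'),
    hbound hlamC.continuousAt, hbound hQC.continuousAt, hbound hGc]
    with T h1 h2 hu hcT hfT hN hb1 hb2 hb3
  have hPJP : P * J T * P = P := by
    rw [hPSP]
    change f (T, lam T) • P = P
    rw [hfT, one_smul]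
  obtain ⟨hTQ, hQT, hQQ⟩ := eigenprojection_of_inverse (Ring.inverse_mul_cancel _ hu)
    (Ring.mul_inverse_cancel _ hu) hPJP hcT (by rw [mul_assoc P]; exact hPSP _)
  obtain ⟨hG1, hG2, hG3, hG4⟩ := reduced_resolvent_of_inverse hTQ hQT hQQ
    (Ring.inverse_mul_cancel _ hN) (Ring.mul_inverse_cancel _ hN)
  refine ⟨h1.continuousAt, h2.continuousAt, hTQ, hQT, hQQ,
    ⟨ψ.comp (J T), (c T)⁻¹ • J T e, fun x => ?_⟩, ?_, ?_, K T * (1 - Q T), hG1, hG2, hG3, hG4, ?_⟩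
  · simp [Q, hP, smul_smul, mul_comm]
  all_goals
    linarith [norm_nonneg (lam R), norm_nonneg (Q R), norm_nonneg (K R * (1 - Q R))]

section Estimates

theorem norm_pow_sub_one_le_of_norm_le_one {w : ℂ} (hw : ‖w‖ ≤ 1) (n : ℕ) :
    ‖w ^ n - 1‖ ≤ n * ‖w - 1‖ := by
  rw [← geom_sum_mul, norm_mul]
  gcongr
  refine (norm_sum_le _ _).trans ?_
  refine (Finset.sum_le_card_nsmul _ _ 1 fun i _ => ?_).trans (by simp)
  rw [norm_pow]
  exact pow_le_one₀ (norm_nonneg _) hw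

theorem norm_pow_sub_one_le (z : ℂ) (n : ℕ) :
    ‖z ^ n - 1‖ ≤
      ∑ j ∈ Finset.range n, (2 * ‖z - 1‖ + (max 1 ‖z‖ - 1) * max 1 ‖z‖ ^ j) := by
  rw [Finset.sum_add_distrib, ← Finset.mul_sum _ _ (max 1 ‖z‖ - 1), mul_geom_sum]
  simp only [Finset.sum_const, Finset.card_range, nsmul_eq_mul]
  rcases le_or_gt ‖z‖ 1 with hz | hz
  · rw [max_eq_left hz]
    have := norm_pow_sub_one_le_of_norm_le_one hz n
    have h0 : (0 : ℝ) ≤ n * ‖z - 1‖ := by positivity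
    simp only [one_pow]
    linarith
  · rw [max_eq_right hz.le]
    set r := ‖z‖ with hr
    have hr0 : (r : ℂ) ≠ 0 := by
      rw [Complex.ofReal_ne_zero]; linarith
    set w : ℂ := z / r with hw
    have hzw : z = w * r := by rw [hw, div_mul_cancel₀ _ hr0]
    have hw1 : ‖w‖ = 1 := by
      rw [hw, norm_div, Complex.norm_real, Real.norm_of_nonneg (by linarith), ← hr,
        div_self (by linarith)]
    have hr1 : r - 1 ≤ ‖z - 1‖ := by
      have := norm_sub_norm_le z 1
      rwa [norm_one] at this
    have hwz : ‖w - z‖ = r - 1 := by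
      have : w - z = w * ((1 - r : ℝ) : ℂ) := by rw [hzw]; push_cast; ring
      rw [this, norm_mul, hw1, one_mul, Complex.norm_real, Real.norm_of_nonpos (by linarith)]
      ring
    have hw2 : ‖w - 1‖ ≤ 2 * ‖z - 1‖ := by
      have := norm_sub_le_norm_sub_add_norm_sub w z 1
      linarith
    have hsplit : z ^ n - 1 = w ^ n * ((r ^ n - 1 : ℝ) : ℂ) + (w ^ n - 1) := by
      rw [hzw]; push_cast; ring
    rw [hsplit]
    refine (norm_add_le _ _).trans ?_
    rw [norm_mul, norm_pow, hw1, one_pow, one_mul, Complex.norm_real,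
      Real.norm_of_nonneg (by linarith [one_le_pow₀ hz.le (n := n)]), add_comm]
    gcongr
    refine (norm_pow_sub_one_le_of_norm_le_one hw1.le n).trans ?_
    gcongr

/-- Summation by parts for a summable sequence whose tail from `k` on is lumped at `k`. -/
theorem sum_mul_add_tail_mul_eq {u : ℕ → ℝ} (hu : Summable u) (f : ℕ → ℝ) (k : ℕ) :
    ∑ n ∈ Finset.range k, u n * ∑ j ∈ Finset.range n, f j +
        (∑' l, u (k + l)) * ∑ j ∈ Finset.range k, f j =
      ∑ j ∈ Finset.range k, f j * ∑' l, u (j + 1 + l) := by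
  induction k with
  | zero => simp
  | succ k ih =>
    have htail : ∑' l, u (k + l) = u k + ∑' l, u (k + 1 + l) := by
      have hs : Summable fun l => u (k + l) := by
        simpa only [add_comm k] using (summable_nat_add_iff k).2 hu
      rw [hs.tsum_eq_zero_add]
      simp only [add_zero, add_assoc, add_comm 1]
    rw [Finset.sum_range_succ _ k, Finset.sum_range_succ _ k, Finset.sum_range_succ _ k, ← ih,
      htail]
    ring

variable {E : Type} [NormedAddCommGroup E] [NormedSpace ℂ E] {Rn : ℕ → E →L[ℂ] E}

theorem Rcaltr_eq (k : ℕ) (z : ℂ) :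
    Rcaltr Rn k z = ∑ n ∈ Finset.range k, z ^ n • Rn n + z ^ k • ∑' l, Rn (k + l) := by
  rw [Rcaltr, Finset.sum_range_succ]
  congr 1
  · refine Finset.sum_congr rfl fun n hn => ?_
    rw [Rntr, if_pos (Finset.mem_range.1 hn)]
  · simp [Rntr]

theorem Rcaltr_one [CompleteSpace E] (hsum : Summable fun j => ‖Rn j‖) (k : ℕ) :
    Rcaltr Rn k 1 = Rcal Rn 1 := by
  simp only [Rcaltr_eq, Rcal, one_pow, one_smul, add_comm k]
  exact hsum.of_norm.sum_add_tsum_nat_add k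

theorem continuous_Rcaltr (k : ℕ) : Continuous (Rcaltr Rn k) := by
  unfold Rcaltr
  fun_prop

theorem norm_Rcaltr_sub_le [CompleteSpace E] (hsum : Summable fun j => ‖Rn j‖) (k : ℕ) (z : ℂ) :
    ‖Rcaltr Rn k z - Rcal Rn 1‖ ≤
      ∑ j ∈ Finset.range k, (2 * ‖z - 1‖ + (max 1 ‖z‖ - 1) * max 1 ‖z‖ ^ j) *
        ∑' l, ‖Rn (j + 1 + l)‖ := by
  have hdiff : Rcaltr Rn k z - Rcal Rn 1 =
      ∑ n ∈ Finset.range k, (z ^ n - 1) • Rn n + (z ^ k - 1) • ∑' l, Rn (k + l) := by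
    rw [← Rcaltr_one hsum k, Rcaltr_eq, Rcaltr_eq]
    simp only [sub_smul, one_pow, one_smul, Finset.sum_sub_distrib]
    abel
  have hs : Summable fun l => ‖Rn (k + l)‖ := by
    simpa only [add_comm k] using (summable_nat_add_iff k).2 hsum
  rw [hdiff, ← sum_mul_add_tail_mul_eq hsum]
  refine (norm_add_le _ _).trans <| add_le_add ((norm_sum_le _ _).trans
    (Finset.sum_le_sum fun n _ => ?_)) ?_
  · rw [norm_smul, mul_comm]
    gcongr
    exact norm_pow_sub_one_le z n
  · rw [norm_smul, mul_comm]
    exact mul_le_mul (norm_tsum_le_tsum_norm hs) (norm_pow_sub_one_le z k) (norm_nonneg _)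
      (tsum_nonneg fun _ => norm_nonneg _)

theorem Sq_zero_nonneg (k : ℕ) (a : ℝ) : 0 ≤ Sq Rn 0 k a :=
  Finset.sum_nonneg fun _ _ => mul_nonneg (mul_nonneg (tsum_nonneg fun _ => norm_nonneg _)
    (by positivity)) (Real.exp_pos _).le

theorem sum_pow_mul_tail_le {r a : ℝ} (hr : 0 ≤ r) (hra : r ≤ Real.exp a) (k : ℕ) :
    ∑ j ∈ Finset.range k, r ^ j * ∑' l, ‖Rn (j + 1 + l)‖ ≤
      ∑' l, ‖Rn (0 + 1 + l)‖ + Sq Rn 0 k a := by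
  have hτ (j : ℕ) : 0 ≤ ∑' l, ‖Rn (j + 1 + l)‖ := tsum_nonneg fun _ => norm_nonneg _
  have hsub : Finset.range k ⊆ insert 0 (Finset.Icc 1 k) := fun j hj => by
    simp only [Finset.mem_range, Finset.mem_insert, Finset.mem_Icc] at hj ⊢
    omega
  refine (Finset.sum_le_sum_of_subset_of_nonneg hsub fun j _ _ =>
    mul_nonneg (pow_nonneg hr _) (hτ j)).trans ?_
  rw [Finset.sum_insert (by simp), pow_zero, one_mul, Sq]
  refine add_le_add_right (Finset.sum_le_sum fun j _ => ?_) _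
  rw [Real.rpow_zero, mul_one, mul_comm, Real.exp_nat_mul]
  exact mul_le_mul_of_nonneg_left (pow_le_pow_left₀ hr hra j) (hτ j)

theorem norm_Rcaltr_sub_le_of_mem [CompleteSpace E] (hsum : Summable fun j => ‖Rn j‖)
    (hstar : Summable fun n : ℕ => ∑' j : ℕ, ‖Rn (n + 1 + j)‖) (k : ℕ) {z : ℂ} {a d : ℝ}
    (hd : d ≤ 1) (hza : ‖z‖ < Real.exp a) (ha : 0 < a) (hzd : ‖z - 1‖ ≤ d) :
    ‖Rcaltr Rn k z - Rcal Rn 1‖ ≤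
      d * (2 * (∑' n, ∑' j, ‖Rn (n + 1 + j)‖) + ∑' j, ‖Rn (0 + 1 + j)‖) +
        2 * (a * Sq Rn 0 k a) := by
  have hτ (j : ℕ) : 0 ≤ ∑' l, ‖Rn (j + 1 + l)‖ := tsum_nonneg fun _ => norm_nonneg _
  have hS := Sq_zero_nonneg (Rn := Rn) k a
  set r := max 1 ‖z‖ with hr
  have hr1 : 1 ≤ r := le_max_left _ _
  have hra : r ≤ Real.exp a := max_le (Real.one_le_exp ha.le) hza.le
  have hrd : r - 1 ≤ d := by
    have h1 := norm_sub_norm_le z 1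
    rw [norm_one] at h1
    have h2 : r ≤ 1 + d := max_le (by linarith [norm_nonneg (z - 1)]) (by linarith)
    linarith
  have hr2a : r - 1 ≤ 2 * a := by
    have h1 : Real.log r ≤ a := (Real.log_le_iff_le_exp (by linarith)).2 hra
    have h2 := Real.one_sub_inv_le_log_of_pos (show 0 < r by linarith)
    have h3 : r * (1 - r⁻¹) = r - 1 := by field_simp
    nlinarith
  refine (norm_Rcaltr_sub_le hsum k z).trans ?_
  simp only [add_mul, Finset.sum_add_distrib, mul_assoc]
  rw [← Finset.mul_sum, ← Finset.mul_sum, ← Finset.mul_sum]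
  have h1 := hstar.sum_le_tsum (Finset.range k) fun j _ => hτ j
  have h2 := sum_pow_mul_tail_le (Rn := Rn) (by linarith : 0 ≤ r) hra k
  have h3 : ‖z - 1‖ * ∑ j ∈ Finset.range k, ∑' l, ‖Rn (j + 1 + l)‖ ≤
      d * ∑' n, ∑' j, ‖Rn (n + 1 + j)‖ :=
    mul_le_mul hzd h1 (Finset.sum_nonneg fun j _ => hτ j) ((norm_nonneg _).trans hzd)
  have h4 := mul_le_mul_of_nonneg_left h2 (by linarith : 0 ≤ r - 1)
  have h5 := mul_le_mul_of_nonneg_right hrd (hτ 0)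
  have h6 := mul_le_mul_of_nonneg_right hr2a hS
  linarith

end Estimates

/-- Proposition 3.2(b)-(d).  Assume (*) and (H2), and suppose
`a(k) S₀(k,a(k)) → 0`.  Then there are `δ > 0`, `k₀ ≥ 1` and `C > 0` such that for every
`k ≥ k₀` there are continuous families `λ'(z)`, `P'(z)` on `D_{a(k)} ∩ B_δ(1)` of simple
eigenvalues of `R'(z)` with rank-one spectral projections, with `λ'(1) = 1`, `P'(1) = P`,
uniform bounds `|λ'(z)| ≤ C`, `‖P'(z)‖ ≤ C`, and with `I - R'(z)` boundedly invertible
(bound `C`) on the range of `Q'(z) = I - P'(z)`. -/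
theorem stmt_7
    {Y : Type} [MeasurableSpace Y] (μ : Measure Y) [IsProbabilityMeasure μ]
    (F : Y → Y) (hFerg : Ergodic F μ)
    (φ : Y → ℕ) (hφmeas : Measurable φ) (hφ1 : ∀ y, 1 ≤ φ y)
    (hφint : Integrable (fun y => (φ y : ℝ)) μ)
    {B : Type} [NormedAddCommGroup B] [NormedSpace ℂ B] [CompleteSpace B]
    -- `B(Y) ⊆ L¹(Y)`, with `‖v‖₁ ≤ ‖v‖` and `1 ∈ B(Y)`
    (ι : B →L[ℂ] Lp ℂ 1 μ) (hι : ∀ b : B, ‖ι b‖ ≤ ‖b‖)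
    (hιinj : Function.Injective fun b : B => ι b)
    (one : B) (hone : ⇑(ι one) =ᵐ[μ] fun _ => (1 : ℂ))
    -- the transfer operator `R` of `F`
    (R : Lp ℂ 1 μ →L[ℂ] Lp ℂ 1 μ)
    (hR : ∀ (v : Lp ℂ 1 μ) (w : Y → ℂ), Measurable w → (∃ c, ∀ y, ‖w y‖ ≤ c) →
      ∫ y, (R v : Y → ℂ) y * w y ∂μ = ∫ y, (v : Y → ℂ) y * w (F y) ∂μ)
    -- `Rₙ v = R (1_{φ = n} v)`, bounded on `B(Y)`
    (Rn : ℕ → B →L[ℂ] B) (hRn0 : Rn 0 = 0)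
    (hRnR : ∀ n : ℕ, 1 ≤ n → ∀ b : B, ∀ g : Lp ℂ 1 μ,
      ⇑g =ᵐ[μ] {y | φ y = n}.indicator ⇑(ι b) →
      ⇑(ι (Rn n b)) =ᵐ[μ] ⇑(R g))
    -- hypothesis (*)
    (hsum : Summable fun j : ℕ => ‖Rn j‖)
    (hstar : Summable fun n : ℕ => ∑' j : ℕ, ‖Rn (n + 1 + j)‖)
    -- hypothesis (H2)
    (P : B →L[ℂ] B)
    (hP : ∀ b : B, P b = (∫ y, (ι b : Y → ℂ) y ∂μ) • one)
    (hRP : (Rcal Rn 1).comp P = P) (hPR : P.comp (Rcal Rn 1) = P)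
    (hspec1 : IsUnit (1 - Rcal Rn 1 + P))
    (hspec2 : ∀ z : ℂ, ‖z‖ ≤ 1 → z ≠ 1 → IsUnit (1 - Rcal Rn z))

    (a : ℕ → ℝ) (ha : ∀ k, 0 < a k)
    (haS : Tendsto (fun k => a k * Sq Rn 0 k (a k)) atTop (nhds 0)) :
    ∃ δ : ℝ, 0 < δ ∧ ∃ k₀ : ℕ, 1 ≤ k₀ ∧ ∃ C : ℝ, 0 < C ∧
      ∀ k, k₀ ≤ k →
        ∃ (lam : ℂ → ℂ) (Pz : ℂ → B →L[ℂ] B),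
          ContinuousOn lam (Metric.ball (0 : ℂ) (Real.exp (a k)) ∩ Metric.ball (1 : ℂ) δ) ∧
          ContinuousOn Pz (Metric.ball (0 : ℂ) (Real.exp (a k)) ∩ Metric.ball (1 : ℂ) δ) ∧
          lam 1 = 1 ∧ Pz 1 = P ∧
          ∀ z ∈ Metric.ball (0 : ℂ) (Real.exp (a k)) ∩ Metric.ball (1 : ℂ) δ,
            Rcaltr Rn k z * Pz z = lam z • Pz z ∧
            Pz z * Rcaltr Rn k z = lam z • Pz z ∧
            Pz z * Pz z = Pz z ∧
            (∃ (ψ : B →L[ℂ] ℂ) (b : B), ∀ x : B, Pz z x = ψ x • b) ∧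
            ‖lam z‖ ≤ C ∧ ‖Pz z‖ ≤ C ∧
            ∃ G : B →L[ℂ] B,
              G * (1 - Pz z) = G ∧ (1 - Pz z) * G = G ∧
              G * (1 - Rcaltr Rn k z) = 1 - Pz z ∧
              (1 - Rcaltr Rn k z) * G = 1 - Pz z ∧ ‖G‖ ≤ C := by
  have hint : ∫ y, (ι one : Y → ℂ) y ∂μ = 1 := by
    rw [integral_congr_ae hone]; simp
  have hone0 : one ≠ 0 := by
    rintro rfl
    rw [map_zero, integral_congr_ae (Lp.coeFn_zero ℂ 1 μ)] at hint
    simp at hint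
  obtain ⟨ℓ, hℓ⟩ := SeparatingDual.exists_eq_one (R := ℂ) hone0
  have hψ (b : B) : (ℓ.comp P) b = ∫ y, (ι b : Y → ℂ) y ∂μ := by
    rw [ContinuousLinearMap.comp_apply, hP, map_smul, hℓ, smul_eq_mul, mul_one]
  obtain ⟨lam, Q, hlam, hQ, C, hC, hev⟩ := exists_eigenprojection_near (ψ := ℓ.comp P) (e := one)
    (by rw [hψ, hint]) (fun b => by rw [hψ, hP]) hRP hPR hspec1
  obtain ⟨ε, hε, hball⟩ := Metric.eventually_nhds_iff_ball.1 hev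
  set M : ℝ := 2 * (∑' n, ∑' j, ‖Rn (n + 1 + j)‖) + ∑' j, ‖Rn (0 + 1 + j)‖
  have hM : 0 ≤ M := add_nonneg (mul_nonneg zero_le_two
    (tsum_nonneg fun _ => tsum_nonneg fun _ => norm_nonneg _)) (tsum_nonneg fun _ => norm_nonneg _)
  obtain ⟨K, hK⟩ := eventually_atTop.1
    (haS.eventually (gt_mem_nhds (show (0 : ℝ) < ε / 4 by positivity)))
  refine ⟨min 1 (ε / (2 * (M + 1))), by positivity, max 1 K, le_max_left _ _, C, hC,
    fun k hk => ?_⟩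
  have hδM : min 1 (ε / (2 * (M + 1))) * M ≤ ε / 2 := by
    calc min 1 (ε / (2 * (M + 1))) * M ≤ ε / (2 * (M + 1)) * (M + 1) := by
          gcongr
          · exact min_le_right _ _
          · linarith
      _ = ε / 2 := by field_simp
  have hmem : ∀ z ∈ Metric.ball (0 : ℂ) (Real.exp (a k)) ∩
      Metric.ball (1 : ℂ) (min 1 (ε / (2 * (M + 1)))),
      Rcaltr Rn k z ∈ Metric.ball (Rcal Rn 1) ε := by
    rintro z ⟨hz0, hz1⟩
    rw [mem_ball_zero_iff] at hz0
    rw [mem_ball_iff_norm] at hz1 ⊢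
    have := norm_Rcaltr_sub_le_of_mem hsum hstar k (min_le_left _ _) hz0 (ha k) hz1.le
    have := hK k ((le_max_right _ _).trans hk)
    linarith
  refine ⟨fun z => lam (Rcaltr Rn k z), fun z => Q (Rcaltr Rn k z), ?_, ?_, ?_, ?_, ?_⟩
  · exact fun z hz => ((hball _ (hmem z hz)).1.comp
      (continuous_Rcaltr k).continuousAt).continuousWithinAt
  · exact fun z hz => ((hball _ (hmem z hz)).2.1.comp
      (continuous_Rcaltr k).continuousAt).continuousWithinAt
  · simp only [Rcaltr_one hsum, hlam]
  · simp only [Rcaltr_one hsum, hQ]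
  · exact fun z hz => (hball _ (hmem z hz)).2.2
end
end
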